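/- There is a constant C₂ depending only on k with the following property. In the setup below, for all sufficiently large n, all η, ε ∈ (0,1) and every subset A ⊆ ℤ_N: | Σ_{x,y,z∈ℤ_N, x+y=z} 1_A(x)1_A(y)𝔞(z) − Σ_{x,y,z∈ℤ_N, x+y=z} 1_A(x)1_A(y)𝔞'(z) | ≤ C₂·K·(ε²·η^{−k·2^{k+3}} + η^{1/(k·2^{k+3}+1)})·N. -/

import Mathlib

open Finset

/-- `e(t) = exp(2πit)`. -/
noncomputable def eC (t : ℝ) : ℂ := Complex.exp (2 * Real.pi * Complex.I * t)

/-- `λ_{b,W}(x) = (φ(W)/W)·log(Wx+b)` if `Wx+b` is prime, and `0` otherwise. -/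
noncomputable def lam (b W x : ℕ) : ℝ :=
  if Nat.Prime (W * x + b) then ((Nat.totient W : ℝ) / W) * Real.log (W * x + b) else 0

/-- The (unnormalized) Fourier transform `f̃(r) = Σ_{x=1}^{N} f(x) e(−xr/N)`
of a function `f : ℤ_N → ℝ`. -/
noncomputable def dft (N : ℕ) (f : ZMod N → ℝ) (r : ZMod N) : ℂ :=
  ∑ x ∈ Finset.Icc 1 N, (f ((x : ℕ) : ZMod N) : ℂ) *
    eC (-(((x : ℕ) : ℝ) * ((r.val : ℕ) : ℝ)) / N)

/-- `‖t‖`: the distance from the real number `t` to the nearest integer. -/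
noncomputable def nint (t : ℝ) : ℝ := |t - round t|


section Fourier

variable {N : ℕ} [NeZero N]

lemma dft_eq_fourier (f : ZMod N → ℝ) (r : ZMod N) :
    dft N f r = ∑ x : ZMod N, (f x : ℂ) * ZMod.stdAddChar (-(x * r)) := by
  have hN : 0 < N := Nat.pos_of_ne_zero (NeZero.ne N)
  unfold dft
  refine Finset.sum_nbij (fun i : ℕ => (i : ZMod N)) (fun _ _ => Finset.mem_univ _) ?_ ?_ ?_
  · intro i hi j hj hij
    simp only [Finset.coe_Icc, Set.mem_Icc] at hi hj
    have h : i ≡ j [MOD N] := (ZMod.natCast_eq_natCast_iff i j N).1 hij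
    rcases le_total i j with hle | hle
    · have h1 : N ∣ j - i := (Nat.modEq_iff_dvd' hle).1 h
      have := Nat.eq_zero_of_dvd_of_lt h1 (by omega)
      omega
    · have h1 : N ∣ i - j := (Nat.modEq_iff_dvd' hle).1 h.symm
      have := Nat.eq_zero_of_dvd_of_lt h1 (by omega)
      omega
  · intro x _
    by_cases hx : x = 0
    · exact ⟨N, by simp; omega, by simp [hx]⟩
    · refine ⟨x.val, ?_, by simp⟩
      have := ZMod.val_lt x
      have := (ZMod.val_ne_zero x).2 hx
      simp only [Finset.coe_Icc, Set.mem_Icc]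
      omega
  · intro i _
    congr 1
    have : -((i : ZMod N) * r) = ((-((i : ℤ) * (r.val : ℤ)) : ℤ) : ZMod N) := by
      push_cast
      simp
    rw [this, ZMod.stdAddChar_coe, eC]
    congr 1
    push_cast
    ring

lemma norm_stdAddChar (x : ZMod N) : ‖(ZMod.stdAddChar x : ℂ)‖ = 1 := by
  rw [ZMod.stdAddChar_apply]
  exact Circle.norm_coe _

lemma conj_stdAddChar (x : ZMod N) :
    (starRingEnd ℂ) (ZMod.stdAddChar x) = ZMod.stdAddChar (-x) :=
  (AddChar.map_neg_eq_conj _ _).symm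

/-- Parseval's identity for the indicator function of a subset of `ZMod N`. -/
lemma sum_norm_sq_indicator (A : Finset (ZMod N)) :
    ∑ r : ZMod N, ‖∑ x ∈ A, (ZMod.stdAddChar (x * r) : ℂ)‖ ^ 2 = N * #A := by
  have key : ∑ r : ZMod N, ((‖∑ x ∈ A, (ZMod.stdAddChar (x * r) : ℂ)‖ ^ 2 : ℝ) : ℂ)
      = N * #A := by
    calc _ = ∑ r : ZMod N, ∑ x ∈ A, ∑ y ∈ A, (ZMod.stdAddChar (r * (x - y)) : ℂ) := by
          refine Finset.sum_congr rfl fun r _ => ?_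
          push_cast
          rw [← Complex.mul_conj', map_sum, Finset.sum_mul_sum]
          refine Finset.sum_congr rfl fun x _ => Finset.sum_congr rfl fun y _ => ?_
          rw [conj_stdAddChar, ← AddChar.map_add_eq_mul]
          congr 1
          ring
      _ = ∑ x ∈ A, ∑ y ∈ A, ∑ r : ZMod N, (ZMod.stdAddChar (r * (x - y)) : ℂ) := by
          rw [Finset.sum_comm]
          exact Finset.sum_congr rfl fun x _ => Finset.sum_comm
      _ = ∑ x ∈ A, ∑ y ∈ A, if x = y then (N : ℂ) else 0 := by
          refine Finset.sum_congr rfl fun x _ => Finset.sum_congr rfl fun y _ => ?_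
          rw [AddChar.sum_mulShift _ (ZMod.isPrimitive_stdAddChar N)]
          simp [sub_eq_zero]
      _ = _ := by simp [mul_comm]
  exact_mod_cast key

lemma norm_sum_sum_le_of_fourier_le (g : ZMod N → ℂ) (A : Finset (ZMod N)) {B : ℝ}
    (hB : ∀ r : ZMod N, ‖∑ x : ZMod N, g x * ZMod.stdAddChar (-(x * r))‖ ≤ B) :
    ‖∑ x ∈ A, ∑ y ∈ A, g (x + y)‖ ≤ B * #A := by
  have hN : (N : ℂ) ≠ 0 := Nat.cast_ne_zero.2 (NeZero.ne N)
  have hN' : (0 : ℝ) < N := Nat.cast_pos.2 (Nat.pos_of_ne_zero (NeZero.ne N))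
  set G : ZMod N → ℂ := fun r => ∑ x : ZMod N, g x * ZMod.stdAddChar (-(x * r)) with hG
  have hinv : ∀ z, (N : ℂ) * g z = ∑ r : ZMod N, G r * ZMod.stdAddChar (z * r) := by
    intro z
    calc (N : ℂ) * g z = ∑ x : ZMod N, g x * (if z - x = 0 then (N : ℂ) else 0) := by
          simp [sub_eq_zero, mul_comm]
      _ = ∑ x : ZMod N, g x * ∑ r : ZMod N, (ZMod.stdAddChar (r * (z - x)) : ℂ) := by
          refine Finset.sum_congr rfl fun x _ => ?_
          rw [AddChar.sum_mulShift _ (ZMod.isPrimitive_stdAddChar N)]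
          simp
      _ = ∑ r : ZMod N, G r * ZMod.stdAddChar (z * r) := by
          simp only [hG, Finset.mul_sum, Finset.sum_mul]
          rw [Finset.sum_comm]
          refine Finset.sum_congr rfl fun x _ => Finset.sum_congr rfl fun y _ => ?_
          rw [mul_assoc, ← AddChar.map_add_eq_mul]
          congr 2
          ring
  have hsum : (N : ℂ) * ∑ x ∈ A, ∑ y ∈ A, g (x + y)
      = ∑ r : ZMod N, G r * (∑ x ∈ A, (ZMod.stdAddChar (x * r) : ℂ)) ^ 2 := by
    calc _ = ∑ x ∈ A, ∑ y ∈ A, ∑ r : ZMod N,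
            G r * (ZMod.stdAddChar (x * r) * ZMod.stdAddChar (y * r)) := by
          rw [Finset.mul_sum]
          refine Finset.sum_congr rfl fun x _ => ?_
          rw [Finset.mul_sum]
          refine Finset.sum_congr rfl fun y _ => ?_
          rw [hinv]
          refine Finset.sum_congr rfl fun r _ => ?_
          rw [← AddChar.map_add_eq_mul, add_mul]
      _ = ∑ r : ZMod N, ∑ x ∈ A, ∑ y ∈ A,
            G r * (ZMod.stdAddChar (x * r) * ZMod.stdAddChar (y * r)) := by
          rw [Finset.sum_comm (s := Finset.univ)]
          exact Finset.sum_congr rfl fun x _ => Finset.sum_comm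
      _ = _ := by
          refine Finset.sum_congr rfl fun r _ => ?_
          rw [sq, Finset.sum_mul_sum, Finset.mul_sum]
          refine Finset.sum_congr rfl fun x _ => ?_
          rw [Finset.mul_sum]
  have hle : (N : ℝ) * ‖∑ x ∈ A, ∑ y ∈ A, g (x + y)‖ ≤ N * (B * #A) := by
    calc (N : ℝ) * ‖∑ x ∈ A, ∑ y ∈ A, g (x + y)‖
        = ‖(N : ℂ) * ∑ x ∈ A, ∑ y ∈ A, g (x + y)‖ := by simp
      _ ≤ ∑ r : ZMod N, B * ‖∑ x ∈ A, (ZMod.stdAddChar (x * r) : ℂ)‖ ^ 2 := by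
          rw [hsum]
          refine (norm_sum_le _ _).trans (Finset.sum_le_sum fun r _ => ?_)
          rw [norm_mul, norm_pow]
          gcongr
          exact hB r
      _ = N * (B * #A) := by
          rw [← Finset.mul_sum, sum_norm_sq_indicator]
          ring
  exact le_of_mul_le_mul_left hle hN'

lemma fourier_conv (f g : ZMod N → ℂ) (r : ZMod N) :
    ∑ x : ZMod N, (∑ y : ZMod N, f y * g (x - y)) * ZMod.stdAddChar (-(x * r))
      = (∑ x : ZMod N, f x * ZMod.stdAddChar (-(x * r)))
        * ∑ x : ZMod N, g x * ZMod.stdAddChar (-(x * r)) := by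
  simp only [Finset.sum_mul]
  rw [Finset.sum_comm]
  refine Finset.sum_congr rfl fun y _ => ?_
  rw [Finset.mul_sum, ← Equiv.sum_comp (Equiv.addRight y)]
  refine Finset.sum_congr rfl fun x _ => ?_
  simp only [Equiv.coe_addRight, add_sub_cancel_right]
  rw [show -((x + y) * r) = -(y * r) + -(x * r) by ring, AddChar.map_add_eq_mul]
  ring

lemma stdAddChar_add_neg (x : ZMod N) :
    (ZMod.stdAddChar x : ℂ) + ZMod.stdAddChar (-x)
      = ((2 * Real.cos (2 * Real.pi * x.val / N) : ℝ) : ℂ) := by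
  have h : x = ((x.val : ℤ) : ZMod N) := by simp
  have h' : -x = ((-(x.val : ℤ) : ℤ) : ZMod N) := by simp
  rw [h', ZMod.stdAddChar_coe]
  nth_rewrite 1 [h]
  rw [ZMod.stdAddChar_coe]
  push_cast
  rw [Complex.two_cos]
  congr 2 <;> ring

lemma nint_add_intCast (t : ℝ) (j : ℤ) : nint (t + j) = nint t := by
  simp [nint, round_add_intCast]

lemma nint_neg (t : ℝ) : nint (-t) = nint t := by
  simp only [nint, abs_sub_round_eq_min]
  by_cases h : Int.fract t = 0
  · have h' : Int.fract (-t) = 0 := Int.fract_neg_eq_zero.2 h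
    rw [h, h']
  · rw [Int.fract_neg h, min_comm]
    ring_nf

lemma one_sub_cos_le_nint (t : ℝ) :
    1 - Real.cos (2 * Real.pi * t) ≤ 2 * Real.pi ^ 2 * nint t ^ 2 := by
  have h : Real.cos (2 * Real.pi * t) = Real.cos (2 * Real.pi * (t - round t)) := by
    rw [show 2 * Real.pi * (t - round t) = 2 * Real.pi * t - round t * (2 * Real.pi) by ring,
      Real.cos_sub_int_mul_two_pi]
  have h2 := Real.one_sub_sq_div_two_le_cos (x := 2 * Real.pi * (t - round t))
  rw [h, nint, sq_abs]
  linarith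

/-- `nint (x r / N)` depends only on the residue of `x r`. -/
lemma nint_val_mul_val (x r : ZMod N) :
    nint ((x.val : ℝ) * (r.val : ℝ) / N) = nint (((x * r).val : ℝ) / N) := by
  have hN : (N : ℝ) ≠ 0 := Nat.cast_ne_zero.2 (NeZero.ne N)
  rw [ZMod.val_mul]
  have h : ((x.val * r.val : ℕ) : ℝ) = ((x.val * r.val % N : ℕ) : ℝ)
      + N * ((x.val * r.val / N : ℕ) : ℝ) := by
    exact_mod_cast (Nat.mod_add_div (x.val * r.val) N).symm
  have h2 : (x.val : ℝ) * (r.val : ℝ) / N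
      = ((x.val * r.val % N : ℕ) : ℝ) / N + ((x.val * r.val / N : ℕ) : ℤ) := by
    rw [← Nat.cast_mul, h, Int.cast_natCast]
    field_simp
  rw [h2, nint_add_intCast]

lemma nint_neg_val (x : ZMod N) : nint (((-x).val : ℝ) / N) = nint ((x.val : ℝ) / N) := by
  have hN : (N : ℝ) ≠ 0 := Nat.cast_ne_zero.2 (NeZero.ne N)
  by_cases hx : x = 0
  · simp [hx]
  · have : NeZero x := ⟨hx⟩
    rw [ZMod.val_neg_of_ne_zero, Nat.cast_sub (ZMod.val_lt x).le, ← nint_neg,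
      ← nint_add_intCast _ 1]
    congr 1
    push_cast
    field_simp
    ring

/-- The Fourier transform of the normalized indicator function of a Bohr set is close to `1` at
the frequencies defining the Bohr set. -/
lemma norm_one_sub_fourier_bohr_le {R S : Finset (ZMod N)} {ε : ℝ} (hε : 0 < ε)
    (hS : ∀ x : ZMod N, x ∈ S ↔ ∀ r ∈ R, nint ((x.val : ℝ) * (r.val : ℝ) / N) ≤ ε)
    {r : ZMod N} (hr : r ∈ R) :
    ‖1 - ∑ x : ZMod N, (((if x ∈ S then (1 : ℝ) else 0) / (#S : ℝ) : ℝ) : ℂ)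
      * ZMod.stdAddChar (-(x * r))‖ ≤ 2 * Real.pi ^ 2 * ε ^ 2 := by
  have h0 : (0 : ZMod N) ∈ S := (hS 0).2 fun r _ => by simpa [nint] using hε.le
  have hcard : (0 : ℝ) < #S := Nat.cast_pos.2 (Finset.card_pos.2 ⟨0, h0⟩)
  have hcard' : (#S : ℂ) ≠ 0 := by exact_mod_cast hcard.ne'
  have hneg : ∀ x, -x ∈ S ↔ x ∈ S := fun x => by
    simp only [hS, nint_val_mul_val, neg_mul, nint_neg_val]
  have hsymm : ∑ x ∈ S, (ZMod.stdAddChar (-(x * r)) : ℂ)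
      = ∑ x ∈ S, (ZMod.stdAddChar (x * r) : ℂ) := by
    refine Finset.sum_nbij' (fun x => -x) (fun x => -x) ?_ ?_ ?_ ?_ ?_ <;> simp [hneg]
  have hreal : 1 - ∑ x : ZMod N, (((if x ∈ S then (1 : ℝ) else 0) / (#S : ℝ) : ℝ) : ℂ)
      * ZMod.stdAddChar (-(x * r))
      = (((∑ x ∈ S, (1 - Real.cos (2 * Real.pi * (((x * r).val : ℝ) / N)))) / #S : ℝ) : ℂ) := by
    have h1 : ∑ x : ZMod N, (((if x ∈ S then (1 : ℝ) else 0) / (#S : ℝ) : ℝ) : ℂ)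
        * ZMod.stdAddChar (-(x * r)) = (∑ x ∈ S, (ZMod.stdAddChar (-(x * r)) : ℂ)) / #S := by
      rw [Finset.sum_div, ← Finset.sum_subset (Finset.subset_univ S)]
      · refine Finset.sum_congr rfl fun x hx => ?_
        simp only [hx, if_true]
        push_cast
        ring
      · intro x _ hx
        simp [hx]
    have h2 : 2 * ∑ x ∈ S, (ZMod.stdAddChar (-(x * r)) : ℂ)
        = 2 * ∑ x ∈ S, ((Real.cos (2 * Real.pi * (((x * r).val : ℝ) / N)) : ℝ) : ℂ) := by
      rw [two_mul]
      nth_rewrite 1 [hsymm]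
      rw [← Finset.sum_add_distrib, Finset.mul_sum]
      refine Finset.sum_congr rfl fun x _ => ?_
      rw [stdAddChar_add_neg, mul_div_assoc]
      push_cast
      rfl
    rw [h1, mul_left_cancel₀ two_ne_zero h2]
    push_cast
    rw [Finset.sum_sub_distrib]
    field_simp
    simp
  have hle : (∑ x ∈ S, (1 - Real.cos (2 * Real.pi * (((x * r).val : ℝ) / N)))) / #S
      ≤ 2 * Real.pi ^ 2 * ε ^ 2 := by
    rw [div_le_iff₀ hcard, mul_comm (2 * Real.pi ^ 2 * ε ^ 2), ← nsmul_eq_mul]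
    refine Finset.sum_le_card_nsmul _ _ _ fun x hx => (one_sub_cos_le_nint _).trans ?_
    have h1 := (hS x).1 hx r hr
    rw [nint_val_mul_val] at h1
    have h2 : 0 ≤ nint (((x * r).val : ℝ) / N) := abs_nonneg _
    gcongr
  rw [hreal, Complex.norm_real, Real.norm_of_nonneg]
  · exact hle
  · exact div_nonneg (Finset.sum_nonneg fun x _ => sub_nonneg.2 (Real.cos_le_one _)) hcard.le

end Fourier

lemma norm_fourier_le_sum {N : ℕ} [NeZero N] (f : ZMod N → ℝ) (r : ZMod N) :
    ‖∑ x : ZMod N, (f x : ℂ) * ZMod.stdAddChar (-(x * r))‖ ≤ ∑ x : ZMod N, |f x| := by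
  refine (norm_sum_le _ _).trans (Finset.sum_le_sum fun x _ => ?_)
  rw [norm_mul, norm_stdAddChar, mul_one, Complex.norm_real, Real.norm_eq_abs]

/-- Convolving twice with the normalized indicator function of the Bohr set of the large spectrum
of `f` hardly changes the number of solutions of `x + y = z` weighted by `f z`. -/
lemma abs_sum_sub_sum_bohr_conv_le {N : ℕ} [NeZero N] {f : ZMod N → ℝ} {C η ε : ℝ}
    (hf : ∑ x : ZMod N, |f x| ≤ C) (hη : 0 < η) (hε : 0 < ε) {R S : Finset (ZMod N)}
    (hR : ∀ r : ZMod N, r ∈ R ↔ η ≤ ‖dft N f r‖)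
    (hS : ∀ x : ZMod N, x ∈ S ↔ ∀ r ∈ R, nint ((x.val : ℝ) * (r.val : ℝ) / N) ≤ ε)
    {β : ZMod N → ℝ} (hβ : ∀ x, β x = (if x ∈ S then (1 : ℝ) else 0) / (#S : ℝ))
    {f' : ZMod N → ℝ}
    (hf' : ∀ x, f' x = ∑ y : ZMod N, (∑ u : ZMod N, f u * β (y - u)) * β (x - y))
    (A : Finset (ZMod N)) :
    |(∑ x : ZMod N, ∑ y : ZMod N,
        (if x ∈ A then (1 : ℝ) else 0) * (if y ∈ A then (1 : ℝ) else 0) * f (x + y))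
      - (∑ x : ZMod N, ∑ y : ZMod N,
        (if x ∈ A then (1 : ℝ) else 0) * (if y ∈ A then (1 : ℝ) else 0) * f' (x + y))|
      ≤ (4 * Real.pi ^ 2 * C * ε ^ 2 + 4 * η) * N := by
  have hC : 0 ≤ C := (Finset.sum_nonneg fun _ _ => abs_nonneg _).trans hf
  have hind : ∀ g : ZMod N → ℝ, ∑ x : ZMod N, ∑ y : ZMod N,
      (if x ∈ A then (1 : ℝ) else 0) * (if y ∈ A then (1 : ℝ) else 0) * g (x + y)
      = ∑ x ∈ A, ∑ y ∈ A, g (x + y) := by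
    intro g
    simp
  have h0 : (0 : ZMod N) ∈ S := (hS 0).2 fun r _ => by simpa [nint] using hε.le
  have hcard : (#S : ℝ) ≠ 0 := Nat.cast_ne_zero.2 (Finset.card_pos.2 ⟨0, h0⟩).ne'
  have hβsum : ∑ x, |β x| ≤ 1 := by
    have : ∀ x, |β x| = (if x ∈ S then (1 : ℝ) else 0) / (#S : ℝ) := fun x => by
      rw [hβ, abs_of_nonneg]
      positivity
    rw [Finset.sum_congr rfl fun x _ => this x, ← Finset.sum_div]
    simp [hcard]
  have key : ∀ r : ZMod N,
      ‖∑ x : ZMod N, ((f x - f' x : ℝ) : ℂ) * ZMod.stdAddChar (-(x * r))‖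
        ≤ 4 * Real.pi ^ 2 * C * ε ^ 2 + 4 * η := by
    intro r
    set F := ∑ x : ZMod N, (f x : ℂ) * ZMod.stdAddChar (-(x * r)) with hF
    set b := ∑ x : ZMod N, (β x : ℂ) * ZMod.stdAddChar (-(x * r)) with hb
    have hconv : ∑ x : ZMod N, ((f x - f' x : ℝ) : ℂ) * ZMod.stdAddChar (-(x * r))
        = F * (1 - b) * (1 + b) := by
      have h1 : ∑ x : ZMod N, (f' x : ℂ) * ZMod.stdAddChar (-(x * r)) = F * b * b := by
        rw [hF, hb, ← fourier_conv, ← fourier_conv]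
        simp [hf']
      push_cast
      simp only [sub_mul, Finset.sum_sub_distrib]
      rw [h1, ← hF]
      ring
    have hFC : ‖F‖ ≤ C := (norm_fourier_le_sum f r).trans hf
    have hb1 : ‖b‖ ≤ 1 := (norm_fourier_le_sum β r).trans hβsum
    have hadd : ‖1 + b‖ ≤ 2 := (norm_add_le _ _).trans (by rw [norm_one]; linarith)
    have hsub : ‖1 - b‖ ≤ 2 := (norm_sub_le _ _).trans (by rw [norm_one]; linarith)
    have hdft : dft N f r = F := dft_eq_fourier f r
    rw [hconv, norm_mul, norm_mul]
    by_cases hr : r ∈ R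
    · have h1 : ‖1 - b‖ ≤ 2 * Real.pi ^ 2 * ε ^ 2 := by
        have := norm_one_sub_fourier_bohr_le hε hS hr
        simpa only [hb, hβ] using this
      calc ‖F‖ * ‖1 - b‖ * ‖1 + b‖ ≤ C * (2 * Real.pi ^ 2 * ε ^ 2) * 2 := by gcongr
        _ ≤ _ := by linarith
    · have h1 : ‖F‖ ≤ η := by
        rw [← hdft]
        exact (not_le.1 (mt (hR r).2 hr)).le
      calc ‖F‖ * ‖1 - b‖ * ‖1 + b‖ ≤ η * 2 * 2 := by gcongr
        _ ≤ 4 * Real.pi ^ 2 * C * ε ^ 2 + 4 * η := by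
          have : 0 ≤ 4 * Real.pi ^ 2 * C * ε ^ 2 := by positivity
          linarith
  have hmain := norm_sum_sum_le_of_fourier_le (fun x => ((f x - f' x : ℝ) : ℂ)) A key
  rw [hind, hind, ← Finset.sum_sub_distrib]
  simp only [← Finset.sum_sub_distrib]
  have hnorm : |∑ x ∈ A, ∑ y ∈ A, (f (x + y) - f' (x + y))|
      = ‖∑ x ∈ A, ∑ y ∈ A, ((f (x + y) - f' (x + y) : ℝ) : ℂ)‖ := by
    rw [← Real.norm_eq_abs, ← Complex.norm_real]
    push_cast
    rfl
  rw [hnorm]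
  refine hmain.trans ?_
  have hA : (#A : ℝ) ≤ N := by
    have := Finset.card_le_univ A
    rw [ZMod.card] at this
    exact_mod_cast this
  gcongr

section Sieve

open ArithmeticFunction

/-- The Ramanujan sum `c_d(n) = ∑_{g ∣ (d, n)} g μ(d / g)`. -/
noncomputable def ramanujanSum (d n : ℕ) : ℝ :=
  ∑ g ∈ d.divisors, if g ∣ n then (g : ℝ) * (moebius (d / g) : ℝ) else 0

lemma ramanujanSum_of_coprime {d n : ℕ} (hd : d ≠ 0) (h : d.Coprime n) :
    ramanujanSum d n = moebius d := by
  unfold ramanujanSum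
  rw [Finset.sum_eq_single_of_mem 1 (by simp [hd])]
  · simp
  · intro g hg hg1
    rw [if_neg]
    intro hgn
    exact hg1 (Nat.eq_one_of_dvd_coprimes h (Nat.dvd_of_mem_divisors hg) hgn)

lemma sum_divisors_filter_dvd_moebius {d t : ℕ} (hd : d ≠ 0) (ht : t ∣ d) :
    ∑ g ∈ d.divisors with t ∣ g, (moebius (d / g) : ℝ) = if t = d then 1 else 0 := by
  obtain ⟨m, rfl⟩ := ht
  have ht0 : 0 < t := Nat.pos_of_ne_zero (left_ne_zero_of_mul hd)
  have hm0 : m ≠ 0 := right_ne_zero_of_mul hd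
  have h1 : ∑ g ∈ (t * m).divisors with t ∣ g, (moebius (t * m / g) : ℝ)
      = ∑ j ∈ m.divisors, (moebius j : ℝ) := by
    rw [← Nat.sum_div_divisors]
    symm
    refine Finset.sum_nbij (fun j => t * j) ?_ ?_ ?_ ?_
    · intro j hj
      simp only [Finset.mem_filter, Nat.mem_divisors]
      exact ⟨⟨mul_dvd_mul_left t (Nat.dvd_of_mem_divisors hj), hd⟩, dvd_mul_right t j⟩
    · intro i _ j _ hij
      exact Nat.eq_of_mul_eq_mul_left ht0 hij
    · intro g hg
      simp only [Finset.coe_filter, Nat.mem_divisors, Set.mem_ofPred_eq] at hg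
      obtain ⟨⟨hg1, -⟩, j, rfl⟩ := hg
      exact ⟨j, by simpa [hm0] using Nat.dvd_of_mul_dvd_mul_left ht0 hg1, rfl⟩
    · intro j _
      rw [Nat.mul_div_mul_left _ _ ht0]
  have h2 := congrArg (fun f : ArithmeticFunction ℤ => f m) coe_zeta_mul_moebius
  simp only [coe_zeta_mul_apply, one_apply] at h2
  rw [h1]
  have h3 : ∑ j ∈ m.divisors, (moebius j : ℝ) = ((if m = 1 then 1 else 0 : ℤ) : ℝ) := by
    rw [← h2]
    push_cast
    rfl
  rw [h3]
  have h4 : t = t * m ↔ m = 1 := by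
    constructor
    · intro h
      exact Nat.eq_of_mul_eq_mul_left ht0 (by rw [mul_one]; exact h.symm)
    · rintro rfl
      simp
  simp [h4]

lemma sum_divisors_moebius_gcd {d e : ℕ} (hd : d ≠ 0) (he : e ≠ 0) :
    ∑ g ∈ d.divisors, ∑ h ∈ e.divisors,
      (moebius (d / g) : ℝ) * (moebius (e / h) : ℝ) * (Nat.gcd g h : ℝ)
      = if d = e then (Nat.totient d : ℝ) else 0 := by
  have hgcd : ∀ g ∈ d.divisors, ∀ h ∈ e.divisors, (Nat.gcd g h : ℝ)
      = ∑ t ∈ d.divisors with t ∣ e, if t ∣ g ∧ t ∣ h then (Nat.totient t : ℝ) else 0 := by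
    intro g hg h hh
    have hg0 := (Nat.pos_of_mem_divisors hg).ne'
    rw [← Finset.sum_filter, ← Nat.sum_totient (Nat.gcd g h), Nat.cast_sum]
    refine Finset.sum_congr ?_ fun _ _ => rfl
    ext t
    simp only [Nat.mem_divisors, Finset.mem_filter, Nat.dvd_gcd_iff]
    constructor
    · rintro ⟨⟨h1, h2⟩, -⟩
      exact ⟨⟨⟨h1.trans (Nat.dvd_of_mem_divisors hg), hd⟩,
        h2.trans (Nat.dvd_of_mem_divisors hh)⟩, h1, h2⟩
    · rintro ⟨-, h1, h2⟩
      exact ⟨⟨h1, h2⟩, Nat.gcd_ne_zero_left hg0⟩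
  calc _ = ∑ g ∈ d.divisors, ∑ h ∈ e.divisors, ∑ t ∈ d.divisors with t ∣ e,
        (Nat.totient t : ℝ) * ((if t ∣ g then (moebius (d / g) : ℝ) else 0)
          * (if t ∣ h then (moebius (e / h) : ℝ) else 0)) := by
        refine Finset.sum_congr rfl fun g hg => Finset.sum_congr rfl fun h hh => ?_
        rw [hgcd g hg h hh, Finset.mul_sum]
        refine Finset.sum_congr rfl fun t _ => ?_
        by_cases h1 : t ∣ g <;> by_cases h2 : t ∣ h <;> simp [h1, h2]
        ring
    _ = ∑ t ∈ d.divisors with t ∣ e, (Nat.totient t : ℝ)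
        * ((∑ g ∈ d.divisors, if t ∣ g then (moebius (d / g) : ℝ) else 0)
          * ∑ h ∈ e.divisors, if t ∣ h then (moebius (e / h) : ℝ) else 0) := by
        rw [Finset.sum_congr rfl fun g _ => Finset.sum_comm, Finset.sum_comm]
        refine Finset.sum_congr rfl fun t _ => ?_
        rw [Finset.sum_mul_sum, Finset.mul_sum]
        refine Finset.sum_congr rfl fun g _ => ?_
        rw [Finset.mul_sum]
    _ = ∑ t ∈ d.divisors with t ∣ e, (Nat.totient t : ℝ)
        * ((if t = d then 1 else 0) * if t = e then 1 else 0) := by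
        refine Finset.sum_congr rfl fun t ht => ?_
        rw [Finset.mem_filter] at ht
        rw [← Finset.sum_filter, ← Finset.sum_filter,
          sum_divisors_filter_dvd_moebius hd (Nat.dvd_of_mem_divisors ht.1),
          sum_divisors_filter_dvd_moebius he ht.2]
    _ = _ := by
        by_cases hde : d = e
        · subst hde
          simp [hd]
        · rw [if_neg hde]
          refine Finset.sum_eq_zero fun t _ => ?_
          by_cases h1 : t = d
          · subst h1
            simp [hde]
          · simp [h1]

/-- The number of multiples of `l` in a progression of length `M` with difference coprime to `l`
is `M / l + O(1)`. -/
lemma abs_card_dvd_progression_sub_le {l q c M : ℕ} (hl : 0 < l) (hlq : l.Coprime q) :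
    |(#{z ∈ Finset.Icc 1 M | l ∣ q * z + c} : ℝ) - (M : ℝ) / l| ≤ 1 := by
  have hex : ∃ v : ℕ, l ∣ q * v + c := by
    have : NeZero l := ⟨hl.ne'⟩
    let u := ZMod.unitOfCoprime q hlq.symm
    refine ⟨((↑u⁻¹ : ZMod l) * -(c : ZMod l)).val, ?_⟩
    rw [← ZMod.natCast_eq_zero_iff]
    push_cast
    rw [ZMod.natCast_zmod_val, ← ZMod.coe_unitOfCoprime q hlq.symm, ← mul_assoc, Units.mul_inv]
    ring
  obtain ⟨v, hv⟩ := hex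
  have hset : (Finset.Icc 1 M).filter (fun z => l ∣ q * z + c)
      = (Finset.Ioc 0 M).filter (fun z => z ≡ v [MOD l]) := by
    ext z
    simp only [Finset.mem_filter, Finset.mem_Icc, Finset.mem_Ioc, Nat.succ_le_iff]
    refine and_congr_right fun _ => ?_
    constructor
    · intro hz
      have h1 : q * z + c ≡ q * v + c [MOD l] :=
        ((Nat.modEq_zero_iff_dvd).2 hz).trans ((Nat.modEq_zero_iff_dvd).2 hv).symm
      exact Nat.ModEq.cancel_left_of_coprime hlq (Nat.ModEq.add_right_cancel' c h1)
    · intro hz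
      exact (Nat.modEq_zero_iff_dvd).1
        (((hz.mul_left q).add_right c).trans ((Nat.modEq_zero_iff_dvd).2 hv))
  have hcard := Nat.Ioc_filter_modEq_card 0 M hl v
  rw [hset]
  set A : ℚ := ((M : ℚ) - v) / l with hA
  set B : ℚ := (((0 : ℕ) : ℚ) - v) / l with hB
  have hAB : A - B = (M : ℚ) / l := by
    rw [hA, hB]
    push_cast
    ring
  have hMl : (0 : ℚ) ≤ (M : ℚ) / l := by positivity
  rw [max_eq_left (sub_nonneg.2 (Int.floor_le_floor (by linarith)))] at hcard
  have hcard' : (#{x ∈ Finset.Ioc 0 M | x ≡ v [MOD l]} : ℚ) = (⌊A⌋ : ℚ) - ⌊B⌋ := by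
    exact_mod_cast hcard
  have key : |(#{x ∈ Finset.Ioc 0 M | x ≡ v [MOD l]} : ℚ) - (M : ℚ) / l| ≤ 1 := by
    rw [hcard', ← hAB, abs_le]
    have := Int.floor_le A
    have := Int.lt_floor_add_one A
    have := Int.floor_le B
    have := Int.lt_floor_add_one B
    constructor <;> linarith
  have key' := (Rat.cast_le (K := ℝ)).2 key
  push_cast at key'
  exact key'

/-- Ramanujan sums are almost orthogonal along a progression whose difference is coprime to the
moduli. -/
lemma abs_sum_ramanujanSum_mul_sub_le {d e q c M : ℕ} (hd : d ≠ 0) (he : e ≠ 0)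
    (hdq : d.Coprime q) (heq : e.Coprime q) :
    |∑ z ∈ Finset.Icc 1 M, ramanujanSum d (q * z + c) * ramanujanSum e (q * z + c)
      - (M : ℝ) * (if d = e then (Nat.totient d : ℝ) else 0)| ≤ (d : ℝ) ^ 2 * (e : ℝ) ^ 2 := by
  have hexp : ∑ z ∈ Finset.Icc 1 M, ramanujanSum d (q * z + c) * ramanujanSum e (q * z + c)
      = ∑ g ∈ d.divisors, ∑ h ∈ e.divisors, ((g : ℝ) * (moebius (d / g) : ℝ))
        * ((h : ℝ) * (moebius (e / h) : ℝ))
        * (#{z ∈ Finset.Icc 1 M | Nat.lcm g h ∣ q * z + c} : ℝ) := by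
    unfold ramanujanSum
    simp only [Finset.sum_mul_sum]
    rw [Finset.sum_comm]
    refine Finset.sum_congr rfl fun g _ => ?_
    rw [Finset.sum_comm]
    refine Finset.sum_congr rfl fun h _ => ?_
    rw [Finset.card_filter, Nat.cast_sum, Finset.mul_sum]
    refine Finset.sum_congr rfl fun z _ => ?_
    by_cases h1 : g ∣ q * z + c <;> by_cases h2 : h ∣ q * z + c <;> simp [h1, h2, Nat.lcm_dvd_iff]
  rw [hexp, ← sum_divisors_moebius_gcd hd he, Finset.mul_sum, ← Finset.sum_sub_distrib]
  simp only [Finset.mul_sum, ← Finset.sum_sub_distrib]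
  have hmu : ∀ n : ℕ, |(moebius n : ℝ)| ≤ 1 := fun n => by
    exact_mod_cast abs_moebius_le_one (n := n)
  have hterm : ∀ g ∈ d.divisors, ∀ h ∈ e.divisors,
      |((g : ℝ) * (moebius (d / g) : ℝ)) * ((h : ℝ) * (moebius (e / h) : ℝ))
        * (#{z ∈ Finset.Icc 1 M | Nat.lcm g h ∣ q * z + c} : ℝ)
        - (M : ℝ) * ((moebius (d / g) : ℝ) * (moebius (e / h) : ℝ) * (Nat.gcd g h : ℝ))|
      ≤ (d : ℝ) * e := by
    intro g hg h hh
    have hg0 := Nat.pos_of_mem_divisors hg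
    have hh0 := Nat.pos_of_mem_divisors hh
    have hl : 0 < Nat.lcm g h := Nat.lcm_pos hg0 hh0
    have hlq : (Nat.lcm g h).Coprime q := by
      refine Nat.Coprime.coprime_dvd_left (Nat.lcm_dvd_mul g h) (Nat.Coprime.mul_left ?_ ?_)
      · exact hdq.coprime_dvd_left (Nat.dvd_of_mem_divisors hg)
      · exact heq.coprime_dvd_left (Nat.dvd_of_mem_divisors hh)
    have hcount := abs_card_dvd_progression_sub_le (c := c) (M := M) hl hlq
    have hgl : (Nat.gcd g h : ℝ) = (g : ℝ) * h / Nat.lcm g h := by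
      rw [eq_div_iff (Nat.cast_ne_zero.2 hl.ne')]
      exact_mod_cast Nat.gcd_mul_lcm g h
    have hgd : (g : ℝ) ≤ d := Nat.cast_le.2 (Nat.divisor_le hg)
    have hhe : (h : ℝ) ≤ e := Nat.cast_le.2 (Nat.divisor_le hh)
    have heq' : ((g : ℝ) * (moebius (d / g) : ℝ)) * ((h : ℝ) * (moebius (e / h) : ℝ))
        * (#{z ∈ Finset.Icc 1 M | Nat.lcm g h ∣ q * z + c} : ℝ)
        - (M : ℝ) * ((moebius (d / g) : ℝ) * (moebius (e / h) : ℝ) * (Nat.gcd g h : ℝ))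
        = (g * h) * ((moebius (d / g) : ℝ) * (moebius (e / h) : ℝ))
          * ((#{z ∈ Finset.Icc 1 M | Nat.lcm g h ∣ q * z + c} : ℝ) - M / Nat.lcm g h) := by
      rw [hgl]
      ring
    rw [heq', abs_mul, abs_mul, abs_mul ((moebius (d / g) : ℝ)),
      abs_of_nonneg (a := (g : ℝ) * h) (by positivity)]
    calc _ ≤ ((d : ℝ) * e) * (1 * 1) * 1 := by
          gcongr
          · exact hmu _
          · exact hmu _
      _ = _ := by ring
  calc _ ≤ ∑ g ∈ d.divisors, ∑ h ∈ e.divisors, (d : ℝ) * e :=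
        (Finset.abs_sum_le_sum_abs _ _).trans (Finset.sum_le_sum fun g hg =>
          (Finset.abs_sum_le_sum_abs _ _).trans (Finset.sum_le_sum fun h hh => hterm g hg h hh))
    _ = (#d.divisors * d : ℝ) * (#e.divisors * e) := by
        simp only [Finset.sum_const, nsmul_eq_mul]
        ring
    _ ≤ (d * d : ℝ) * (e * e) := by
        gcongr
        · exact Nat.card_divisors_le_self d
        · exact Nat.card_divisors_le_self e
    _ = _ := by ring

/-- The sum `∑ μ(d)² / φ(d)` over `d ≤ D` coprime to `q`, the denominator in Selberg's sieve. -/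
noncomputable def selbergDenom (q D : ℕ) : ℝ :=
  ∑ d ∈ Finset.Icc 1 D with d.Coprime q, (moebius d : ℝ) ^ 2 / Nat.totient d

/-- Selberg's upper bound for the number of primes in an arithmetic progression. -/
lemma card_primes_progression_mul_le (q c M D : ℕ) :
    (#{z ∈ Finset.Icc 1 M | (q * z + c).Prime ∧ D < q * z + c} : ℝ) * selbergDenom q D ^ 2
      ≤ M * selbergDenom q D + (D : ℝ) ^ 6 := by
  set T := (Finset.Icc 1 D).filter (fun d => d.Coprime q) with hT
  set a : ℕ → ℝ := fun d => (moebius d : ℝ) / Nat.totient d with ha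
  set f : ℕ → ℝ := fun n => ∑ d ∈ T, a d * ramanujanSum d n with hf
  have hTd : ∀ d ∈ T, d ≠ 0 ∧ d ≤ D ∧ d.Coprime q := by
    intro d hd
    simp only [hT, Finset.mem_filter, Finset.mem_Icc] at hd
    exact ⟨by omega, hd.1.2, hd.2⟩
  have ha1 : ∀ d ∈ T, |a d| ≤ 1 := by
    intro d hd
    have h1 : (1 : ℝ) ≤ Nat.totient d := by
      exact_mod_cast Nat.totient_pos.2 (Nat.pos_of_ne_zero (hTd d hd).1)
    have h2 : |(moebius d : ℝ)| ≤ 1 := by exact_mod_cast abs_moebius_le_one (n := d)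
    rw [ha]
    simp only
    rw [abs_div, abs_of_pos (by linarith : (0 : ℝ) < Nat.totient d)]
    exact div_le_one_of_le₀ (h2.trans h1) (by positivity)
  have hprime : ∀ n : ℕ, n.Prime → D < n → f n = selbergDenom q D := by
    intro n hn hDn
    rw [hf, selbergDenom]
    refine Finset.sum_congr rfl fun d hd => ?_
    have hcop : d.Coprime n := ((Nat.Prime.coprime_iff_not_dvd hn).2 fun h =>
      absurd (Nat.le_of_dvd (Nat.pos_of_ne_zero (hTd d hd).1) h)
        (by have := (hTd d hd).2.1; omega)).symm
    rw [ramanujanSum_of_coprime (hTd d hd).1 hcop, ha]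
    ring
  have hsq : ∑ z ∈ Finset.Icc 1 M, f (q * z + c) ^ 2 = ∑ d ∈ T, ∑ e ∈ T, a d * a e
      * ∑ z ∈ Finset.Icc 1 M, ramanujanSum d (q * z + c) * ramanujanSum e (q * z + c) := by
    simp only [hf, sq, Finset.sum_mul_sum]
    simp only [Finset.mul_sum]
    rw [Finset.sum_comm]
    refine Finset.sum_congr rfl fun d _ => ?_
    rw [Finset.sum_comm]
    refine Finset.sum_congr rfl fun e _ => Finset.sum_congr rfl fun z _ => ?_
    ring
  have hdiag : ∑ d ∈ T, ∑ e ∈ T, a d * a e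
      * ((M : ℝ) * (if d = e then (Nat.totient d : ℝ) else 0)) = M * selbergDenom q D := by
    rw [selbergDenom, Finset.mul_sum]
    refine Finset.sum_congr rfl fun d hd => ?_
    have h0 : (Nat.totient d : ℝ) ≠ 0 :=
      Nat.cast_ne_zero.2 (Nat.totient_pos.2 (Nat.pos_of_ne_zero (hTd d hd).1)).ne'
    rw [Finset.sum_eq_single_of_mem d hd]
    · simp only [if_true, ha]
      field_simp
    · intro e _ hed
      simp [hed.symm]
  have herr : ∑ d ∈ T, ∑ e ∈ T, a d * a e
      * (∑ z ∈ Finset.Icc 1 M, ramanujanSum d (q * z + c) * ramanujanSum e (q * z + c)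
        - (M : ℝ) * (if d = e then (Nat.totient d : ℝ) else 0)) ≤ (D : ℝ) ^ 6 := by
    calc _ ≤ ∑ d ∈ T, ∑ e ∈ T, (D : ℝ) ^ 2 * (D : ℝ) ^ 2 := by
          refine Finset.sum_le_sum fun d hd => Finset.sum_le_sum fun e he => ?_
          refine (le_abs_self _).trans ?_
          rw [abs_mul, abs_mul]
          have h1 := abs_sum_ramanujanSum_mul_sub_le (c := c) (M := M) (hTd d hd).1 (hTd e he).1
            (hTd d hd).2.2 (hTd e he).2.2
          have hdD : (d : ℝ) ≤ D := Nat.cast_le.2 (hTd d hd).2.1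
          have heD : (e : ℝ) ≤ D := Nat.cast_le.2 (hTd e he).2.1
          calc _ ≤ 1 * 1 * ((d : ℝ) ^ 2 * (e : ℝ) ^ 2) := by
                gcongr
                · exact ha1 d hd
                · exact ha1 e he
            _ ≤ 1 * 1 * ((D : ℝ) ^ 2 * (D : ℝ) ^ 2) := by gcongr
            _ = _ := by ring
      _ = (#T : ℝ) * #T * D ^ 4 := by
          simp only [Finset.sum_const, nsmul_eq_mul]
          ring
      _ ≤ (D : ℝ) * D * D ^ 4 := by
          have : (#T : ℝ) ≤ D := by
            have := Finset.card_filter_le (Finset.Icc 1 D) (fun d => d.Coprime q)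
            rw [Nat.card_Icc, Nat.add_sub_cancel] at this
            exact_mod_cast this
          gcongr
      _ = _ := by ring
  calc _ = ∑ z ∈ Finset.Icc 1 M with (q * z + c).Prime ∧ D < q * z + c, f (q * z + c) ^ 2 := by
        rw [← nsmul_eq_mul, ← Finset.sum_const]
        refine Finset.sum_congr rfl fun z hz => ?_
        rw [Finset.mem_filter] at hz
        rw [hprime _ hz.2.1 hz.2.2]
    _ ≤ ∑ z ∈ Finset.Icc 1 M, f (q * z + c) ^ 2 :=
        Finset.sum_le_sum_of_subset_of_nonneg (Finset.filter_subset _ _) fun _ _ _ => sq_nonneg _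
    _ ≤ _ := by
        rw [hsq, ← hdiag, ← sub_le_iff_le_add', ← Finset.sum_sub_distrib]
        simp only [← Finset.sum_sub_distrib, ← mul_sub]
        exact herr

lemma totient_mul_harmonic_le (q J : ℕ) (hq : 0 < q) :
    (Nat.totient q : ℝ) / q * ∑ j ∈ Finset.Icc 1 J, (j : ℝ)⁻¹
      ≤ ∑ n ∈ Finset.Icc 1 (q * J) with n.Coprime q, (n : ℝ)⁻¹ := by
  induction J with
  | zero => simp
  | succ J ih =>
    have hq' : (0 : ℝ) < q := Nat.cast_pos.2 hq
    rw [Finset.sum_Icc_succ_top (by omega), mul_add]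
    have hunion : (Finset.Icc 1 (q * (J + 1))).filter (fun n => n.Coprime q)
        = (Finset.Icc 1 (q * J)).filter (fun n => n.Coprime q)
          ∪ (Finset.Ico (q * J + 1) (q * J + 1 + q)).filter (fun n => q.Coprime n) := by
      ext n
      simp only [Finset.mem_filter, Finset.mem_union, Finset.mem_Icc, Finset.mem_Ico,
        Nat.coprime_comm (m := q), ← or_and_right, mul_add, mul_one]
      refine and_congr_left fun _ => ?_
      omega
    have hdisj : Disjoint ((Finset.Icc 1 (q * J)).filter (fun n => n.Coprime q))
        ((Finset.Ico (q * J + 1) (q * J + 1 + q)).filter (fun n => q.Coprime n)) := by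
      rw [Finset.disjoint_left]
      intro n hn hn'
      simp only [Finset.mem_filter, Finset.mem_Icc, Finset.mem_Ico] at hn hn'
      omega
    rw [hunion, Finset.sum_union hdisj]
    refine add_le_add ih ?_
    calc _ = (#{n ∈ Finset.Ico (q * J + 1) (q * J + 1 + q) | q.Coprime n} : ℝ)
          * ((q * (J + 1) : ℕ) : ℝ)⁻¹ := by
          rw [Nat.filter_coprime_Ico_eq_totient]
          push_cast
          field_simp
      _ ≤ _ := by
          rw [← nsmul_eq_mul]
          refine Finset.card_nsmul_le_sum _ _ _ fun n hn => ?_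
          simp only [Finset.mem_filter, Finset.mem_Ico] at hn
          have h1 : n ≤ q * (J + 1) := by rw [mul_add, mul_one]; omega
          have h2 : (0 : ℝ) < n := Nat.cast_pos.2 (by omega)
          exact inv_anti₀ h2 (Nat.cast_le.2 h1)

lemma sum_inv_sq_le_two (D : ℕ) : ∑ s ∈ Finset.Icc 1 D, ((s : ℝ) ^ 2)⁻¹ ≤ 2 := by
  have h := sum_Ioo_inv_sq_le (α := ℝ) 0 (D + 1)
  have h2 : Finset.Ioo 0 (D + 1) = Finset.Icc 1 D := by
    ext
    simp only [Finset.mem_Ioo, Finset.mem_Icc]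
    omega
  rw [h2] at h
  norm_num at h ⊢
  exact h

lemma sum_inv_coprime_le (q D : ℕ) :
    ∑ n ∈ Finset.Icc 1 D with n.Coprime q, (n : ℝ)⁻¹ ≤ 2 * selbergDenom q D := by
  choose a b hab hsq using Nat.sq_mul_squarefree
  have hb : ∀ n, 1 ≤ n → b n ^ 2 ≠ 0 ∧ a n ≠ 0 := by
    intro n hn
    have : b n ^ 2 * a n ≠ 0 := by rw [hab]; omega
    exact ⟨left_ne_zero_of_mul this, right_ne_zero_of_mul this⟩
  have hinj : Set.InjOn (fun n => (b n, a n))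
      ((Finset.Icc 1 D).filter (fun n => n.Coprime q) : Set ℕ) := by
    intro n _ m _ h
    simp only [Prod.mk.injEq] at h
    rw [← hab n, ← hab m, h.1, h.2]
  set U := (Finset.Icc 1 D).filter (fun n => n.Coprime q ∧ Squarefree n) with hU
  calc _ = ∑ n ∈ Finset.Icc 1 D with n.Coprime q, ((b n : ℝ) ^ 2)⁻¹ * (a n : ℝ)⁻¹ := by
        refine Finset.sum_congr rfl fun n _ => ?_
        rw [← mul_inv]
        congr 1
        exact_mod_cast (hab n).symm
    _ = ∑ p ∈ ((Finset.Icc 1 D).filter (fun n => n.Coprime q)).image (fun n => (b n, a n)),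
          ((p.1 : ℝ) ^ 2)⁻¹ * (p.2 : ℝ)⁻¹ := by
        rw [Finset.sum_image hinj]
    _ ≤ ∑ p ∈ Finset.Icc 1 D ×ˢ U, ((p.1 : ℝ) ^ 2)⁻¹ * (p.2 : ℝ)⁻¹ := by
        refine Finset.sum_le_sum_of_subset_of_nonneg ?_ fun _ _ _ => by positivity
        intro p hp
        obtain ⟨n, hn, rfl⟩ := Finset.mem_image.1 hp
        simp only [Finset.mem_filter, Finset.mem_Icc] at hn
        obtain ⟨⟨hn1, hnD⟩, hnq⟩ := hn
        obtain ⟨h1, h2⟩ := hb n hn1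
        have h3 : b n ∣ n := Dvd.intro (b n * a n) (by rw [← mul_assoc, ← sq]; exact hab n)
        have h4 : a n ∣ n := Dvd.intro_left _ (hab n)
        have h5 := Nat.le_of_dvd (by omega) h3
        have h6 := Nat.le_of_dvd (by omega) h4
        have h7 : b n ≠ 0 := fun h => h1 (by simp [h])
        simp only [hU, Finset.mem_product, Finset.mem_filter, Finset.mem_Icc]
        exact ⟨⟨by omega, by omega⟩, ⟨by omega, by omega⟩,
          hnq.coprime_dvd_left h4, hsq n⟩
    _ = (∑ s ∈ Finset.Icc 1 D, ((s : ℝ) ^ 2)⁻¹) * ∑ m ∈ U, (m : ℝ)⁻¹ := by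
        rw [Finset.sum_mul_sum, Finset.sum_product]
    _ ≤ 2 * selbergDenom q D := by
        refine mul_le_mul (sum_inv_sq_le_two D) ?_ (by positivity) (by norm_num)
        rw [selbergDenom]
        calc ∑ m ∈ U, (m : ℝ)⁻¹ ≤ ∑ m ∈ U, (moebius m : ℝ) ^ 2 / Nat.totient m := by
              refine Finset.sum_le_sum fun m hm => ?_
              simp only [hU, Finset.mem_filter, Finset.mem_Icc] at hm
              have h1 : (moebius m : ℝ) ^ 2 = 1 := by
                exact_mod_cast moebius_sq_eq_one_of_squarefree hm.2.2
              rw [h1, one_div]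
              exact inv_anti₀ (Nat.cast_pos.2 (Nat.totient_pos.2 (by omega)))
                (Nat.cast_le.2 (Nat.totient_le m))
          _ ≤ _ := by
              refine Finset.sum_le_sum_of_subset_of_nonneg ?_ fun _ _ _ => by positivity
              intro m hm
              simp only [hU, Finset.mem_filter] at hm ⊢
              exact ⟨hm.1, hm.2.1⟩

lemma totient_mul_log_le_selbergDenom (q J : ℕ) (hq : 0 < q) :
    (Nat.totient q : ℝ) / q * Real.log (J + 1) ≤ 2 * selbergDenom q (q * J) := by
  refine le_trans ?_ ((totient_mul_harmonic_le q J hq).trans (sum_inv_coprime_le q (q * J)))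
  have h := log_add_one_le_harmonic J
  rw [harmonic_eq_sum_Icc] at h
  push_cast at h
  gcongr

lemma one_le_selbergDenom (q D : ℕ) (hD : 1 ≤ D) : 1 ≤ selbergDenom q D := by
  have h : (1 : ℕ) ∈ (Finset.Icc 1 D).filter (fun d => d.Coprime q) := by simp [hD]
  have := Finset.single_le_sum (f := fun d : ℕ => (moebius d : ℝ) ^ 2 / Nat.totient d)
    (fun _ _ => by positivity) h
  simpa [selbergDenom] using this

lemma lam_nonneg (c q z : ℕ) : 0 ≤ lam c q z := by
  unfold lam
  split_ifs
  · have : 0 ≤ Real.log ((q : ℝ) * z + c) := by exact_mod_cast Real.log_natCast_nonneg (q * z + c)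
    positivity
  · exact le_rfl

lemma log_progression_le {q c M J z : ℕ} (hq : 0 < q) (hc : c ≤ q) (hJ : 2 ≤ J) (hqJ : q ≤ J)
    (hJM : J ≤ M) (hMJ : M < (J + 1) ^ 12) (hz1 : 1 ≤ z) (hzM : z ≤ M) :
    Real.log ((q : ℝ) * z + c) ≤ 36 * Real.log ((J : ℝ) + 1) := by
  have hM2 : 2 ≤ M := hJ.trans hJM
  have hqM : q ≤ M := hqJ.trans hJM
  have h1 : q * z + c ≤ M ^ 3 := calc
    q * z + c ≤ M * M + M := Nat.add_le_add (Nat.mul_le_mul hqM hzM) (hc.trans hqM)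
    _ ≤ M ^ 3 := by nlinarith
  have h2 : (q : ℝ) * z + c ≤ (M : ℝ) ^ 3 := by exact_mod_cast h1
  have h3 : (M : ℝ) ≤ ((J : ℝ) + 1) ^ 12 := by exact_mod_cast hMJ.le
  have h4 : (0 : ℝ) < (q : ℝ) * z + c := by
    have : (0 : ℝ) < z := Nat.cast_pos.2 hz1
    positivity
  calc _ ≤ Real.log ((((J : ℝ) + 1) ^ 12) ^ 3) :=
        Real.log_le_log h4 (h2.trans (pow_le_pow_left₀ (Nat.cast_nonneg M) h3 3))
    _ = 36 * Real.log ((J : ℝ) + 1) := by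
      rw [Real.log_pow, Real.log_pow]
      push_cast
      ring

/-- A Brun–Titchmarsh bound in progressions with small difference. -/
lemma sum_lam_le {q c M J : ℕ} (hq : 0 < q) (hc : c ≤ q) (hJ : 2 ≤ J) (hqJ : q ≤ J)
    (hJM : J ^ 12 ≤ M) (hMJ : M < (J + 1) ^ 12) :
    ∑ z ∈ Finset.Icc 1 M, lam c q z ≤ 180 * M := by
  set D := q * J with hD
  set S := selbergDenom q D with hS
  set ρ : ℝ := (Nat.totient q : ℝ) / q with hρ
  set L := Real.log ((J : ℝ) + 1) with hL
  set P := (Finset.Icc 1 M).filter (fun z => (q * z + c).Prime ∧ D < q * z + c) with hP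
  have hq' : (0 : ℝ) < q := Nat.cast_pos.2 hq
  have hρ0 : 0 ≤ ρ := by positivity
  have hρ1 : ρ ≤ 1 := div_le_one_of_le₀ (Nat.cast_le.2 (Nat.totient_le q)) hq'.le
  have hL0 : 0 ≤ L := Real.log_nonneg (by linarith [Nat.cast_nonneg (α := ℝ) J])
  have hLJ : L ≤ J := by
    have := Real.log_le_sub_one_of_pos (show (0 : ℝ) < J + 1 by positivity)
    linarith
  have hD1 : 1 ≤ D := Nat.mul_pos hq (by omega)
  have hDJ : D ≤ J ^ 2 := by rw [sq]; exact Nat.mul_le_mul_right J hqJ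
  have hS1 : 1 ≤ S := one_le_selbergDenom q D hD1
  have hρL : ρ * L ≤ 2 * S := totient_mul_log_le_selbergDenom q J hq
  have hM : J ≤ M := (Nat.le_self_pow (by norm_num) J).trans hJM
  have hD6 : (D : ℝ) ^ 6 ≤ M := by
    have : D ^ 6 ≤ M := calc
      D ^ 6 ≤ (J ^ 2) ^ 6 := Nat.pow_le_pow_left hDJ 6
      _ = J ^ 12 := by ring
      _ ≤ M := hJM
    exact_mod_cast this
  have hPS : (#P : ℝ) * S ≤ 2 * M := by
    have h := card_primes_progression_mul_le q c M D
    have h2 : (#P : ℝ) * S * S ≤ 2 * M * S := by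
      have h3 : (M : ℝ) ≤ M * S := le_mul_of_one_le_right (Nat.cast_nonneg _) hS1
      rw [← hP, ← hS] at h
      nlinarith
    exact le_of_mul_le_mul_right h2 (by linarith)
  have hlam : ∀ z ∈ Finset.Icc 1 M, lam c q z
      ≤ (if (q * z + c).Prime ∧ D < q * z + c then 36 * (ρ * L) else 0)
        + if z ≤ D then 36 * L else 0 := by
    intro z hz
    rw [Finset.mem_Icc] at hz
    have hlog : Real.log ((q : ℝ) * z + c) ≤ 36 * L :=
      log_progression_le hq hc hJ hqJ hM hMJ hz.1 hz.2
    unfold lam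
    split_ifs with h1 h2 h3 h4 h5 h6
    · have : ρ * Real.log ((q : ℝ) * z + c) ≤ ρ * (36 * L) := by gcongr
      linarith
    · have : ρ * Real.log ((q : ℝ) * z + c) ≤ ρ * (36 * L) := by gcongr
      linarith
    · have h0 : 0 ≤ Real.log ((q : ℝ) * z + c) := by
        exact_mod_cast Real.log_natCast_nonneg (q * z + c)
      have : ρ * Real.log ((q : ℝ) * z + c) ≤ 1 * (36 * L) := by gcongr
      linarith
    · exfalso
      apply h2
      refine ⟨h1, ?_⟩
      have : z ≤ q * z := Nat.le_mul_of_pos_left z hq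
      omega
    · positivity
    · positivity
    · positivity
    · positivity
  calc _ ≤ ∑ z ∈ Finset.Icc 1 M, ((if (q * z + c).Prime ∧ D < q * z + c then 36 * (ρ * L) else 0)
        + if z ≤ D then 36 * L else 0) := Finset.sum_le_sum hlam
    _ = #P * (36 * (ρ * L)) + #{z ∈ Finset.Icc 1 M | z ≤ D} * (36 * L) := by
        rw [Finset.sum_add_distrib, ← Finset.sum_filter, ← Finset.sum_filter, Finset.sum_const,
          Finset.sum_const, nsmul_eq_mul, nsmul_eq_mul]
    _ ≤ #P * (36 * (2 * S)) + (J ^ 2 : ℕ) * (36 * J) := by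
        have hcard : #{z ∈ Finset.Icc 1 M | z ≤ D} ≤ J ^ 2 := by
          refine le_trans ?_ hDJ
          calc _ ≤ #(Finset.Icc 1 D) := Finset.card_le_card fun z hz => by
                simp only [Finset.mem_filter, Finset.mem_Icc] at hz ⊢
                omega
            _ = D := by simp
        gcongr
    _ ≤ 180 * M := by
        have h3 : (J : ℝ) ^ 3 ≤ M := by
          exact_mod_cast (Nat.pow_le_pow_right (by omega) (by norm_num : 3 ≤ 12)).trans hJM
        push_cast
        nlinarith

end Sieve

section Growth

/-- The sum of the absolute values of the non-leading coefficients. -/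
noncomputable def lowerHeight (ψ : Polynomial ℤ) : ℝ :=
  ∑ i ∈ Finset.range ψ.natDegree, |(ψ.coeff i : ℝ)|

lemma lowerHeight_nonneg (ψ : Polynomial ℤ) : 0 ≤ lowerHeight ψ :=
  Finset.sum_nonneg fun _ _ => abs_nonneg _

lemma eval_sub_eval_eq (ψ : Polynomial ℤ) (u v : ℤ) :
    ((ψ.eval u - ψ.eval v : ℤ) : ℝ)
      = ∑ i ∈ Finset.range ψ.natDegree, (ψ.coeff i : ℝ) * ((u : ℝ) ^ i - (v : ℝ) ^ i)
        + (ψ.leadingCoeff : ℝ) * ((u : ℝ) ^ ψ.natDegree - (v : ℝ) ^ ψ.natDegree) := by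
  rw [Polynomial.eval_eq_sum_range, Polynomial.eval_eq_sum_range, ← Finset.sum_sub_distrib,
    Finset.sum_range_succ]
  push_cast
  simp only [← mul_sub]
  rfl

lemma mul_pow_sub_pow_le {u v X : ℝ} (hv : 0 ≤ v) (hvu : v ≤ u) (huX : u ≤ X) (i : ℕ) :
    X * (u ^ i - v ^ i) ≤ (u - v) * (i * X ^ i) := by
  induction i with
  | zero => simp
  | succ i ih =>
    have hu : 0 ≤ u := hv.trans hvu
    have hX : 0 ≤ X := hu.trans huX
    have h1 : 0 ≤ u ^ i - v ^ i := sub_nonneg.2 (pow_le_pow_left₀ hv hvu i)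
    calc X * (u ^ (i + 1) - v ^ (i + 1))
        = u * (X * (u ^ i - v ^ i)) + (u - v) * (X * v ^ i) := by ring
      _ ≤ X * ((u - v) * (i * X ^ i)) + (u - v) * (X * X ^ i) := by
          have h2 : v ^ i ≤ X ^ i := pow_le_pow_left₀ hv (hvu.trans huX) i
          have h3 : 0 ≤ u - v := sub_nonneg.2 hvu
          gcongr
      _ = (u - v) * (((i + 1 : ℕ) : ℝ) * X ^ (i + 1)) := by
          push_cast
          ring

lemma sum_abs_coeff_mul_pow_le (ψ : Polynomial ℤ) (hk : 1 ≤ ψ.natDegree) {X : ℝ} (hX : 1 ≤ X) :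
    ∑ i ∈ Finset.range ψ.natDegree, |(ψ.coeff i : ℝ)| * X ^ i
      ≤ lowerHeight ψ * X ^ (ψ.natDegree - 1) := by
  rw [lowerHeight, Finset.sum_mul]
  refine Finset.sum_le_sum fun i hi => ?_
  rw [Finset.mem_range] at hi
  gcongr
  omega

lemma mul_abs_eval_sub_eval_le (ψ : Polynomial ℤ) (hk : 1 ≤ ψ.natDegree)
    (hlead : 0 < ψ.leadingCoeff) {u v : ℤ} {X : ℝ} (hv : 0 ≤ v) (hvu : v ≤ u) (huX : (u : ℝ) ≤ X)
    (hX : 1 ≤ X) (hHX : lowerHeight ψ ≤ X) :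
    X * |((ψ.eval u - ψ.eval v : ℤ) : ℝ)|
      ≤ ((u : ℝ) - v) * (2 * ψ.natDegree * ψ.leadingCoeff * X ^ ψ.natDegree) := by
  set k := ψ.natDegree with hkdef
  have hv' : (0 : ℝ) ≤ v := by exact_mod_cast hv
  have hvu' : (v : ℝ) ≤ u := by exact_mod_cast hvu
  have hlead' : (1 : ℝ) ≤ ψ.leadingCoeff := by exact_mod_cast hlead
  have hX0 : 0 ≤ X := by linarith
  have hd : (0 : ℝ) ≤ (u : ℝ) - v := sub_nonneg.2 hvu'
  have hpow : ∀ i : ℕ, (0 : ℝ) ≤ (u : ℝ) ^ i - (v : ℝ) ^ i := fun i =>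
    sub_nonneg.2 (pow_le_pow_left₀ hv' hvu' i)
  rw [eval_sub_eval_eq]
  calc _ ≤ X * (∑ i ∈ Finset.range k, |(ψ.coeff i : ℝ)| * ((u : ℝ) ^ i - (v : ℝ) ^ i)
        + (ψ.leadingCoeff : ℝ) * ((u : ℝ) ^ k - (v : ℝ) ^ k)) := by
        gcongr
        refine (abs_add_le _ _).trans (add_le_add ((Finset.abs_sum_le_sum_abs _ _).trans ?_) ?_)
        · refine Finset.sum_le_sum fun i _ => ?_
          rw [abs_mul, abs_of_nonneg (hpow i)]
        · rw [abs_of_nonneg (mul_nonneg (by linarith) (hpow _))]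
    _ = ∑ i ∈ Finset.range k, |(ψ.coeff i : ℝ)| * (X * ((u : ℝ) ^ i - (v : ℝ) ^ i))
        + (ψ.leadingCoeff : ℝ) * (X * ((u : ℝ) ^ k - (v : ℝ) ^ k)) := by
        rw [mul_add, Finset.mul_sum]
        congr 1
        · exact Finset.sum_congr rfl fun i _ => by ring
        · ring
    _ ≤ ∑ i ∈ Finset.range k, |(ψ.coeff i : ℝ)| * (((u : ℝ) - v) * (k * X ^ i))
        + (ψ.leadingCoeff : ℝ) * (((u : ℝ) - v) * (k * X ^ k)) := by
        refine add_le_add (Finset.sum_le_sum fun i hi => ?_) ?_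
        · rw [Finset.mem_range] at hi
          have hik : (i : ℝ) ≤ k := Nat.cast_le.2 hi.le
          refine mul_le_mul_of_nonneg_left ((mul_pow_sub_pow_le hv' hvu' huX i).trans ?_)
            (abs_nonneg _)
          gcongr
        · exact mul_le_mul_of_nonneg_left (mul_pow_sub_pow_le hv' hvu' huX k) (by linarith)
    _ = ((u : ℝ) - v) * (k * (∑ i ∈ Finset.range k, |(ψ.coeff i : ℝ)| * X ^ i
        + ψ.leadingCoeff * X ^ k)) := by
        rw [mul_add (k : ℝ), Finset.mul_sum, mul_add, Finset.mul_sum]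
        congr 1
        · exact Finset.sum_congr rfl fun i _ => by ring
        · ring
    _ ≤ ((u : ℝ) - v) * (k * (ψ.leadingCoeff * X ^ k + ψ.leadingCoeff * X ^ k)) := by
        gcongr
        calc _ ≤ lowerHeight ψ * X ^ (k - 1) := sum_abs_coeff_mul_pow_le ψ hk hX
          _ ≤ X * X ^ (k - 1) := by gcongr
          _ = 1 * X ^ k := by
              rw [one_mul, ← pow_succ', Nat.sub_add_cancel hk]
          _ ≤ ψ.leadingCoeff * X ^ k := by gcongr
    _ = _ := by ring

lemma half_mul_pow_le_eval_sub_eval (ψ : Polynomial ℤ) (hk : 1 ≤ ψ.natDegree)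
    (hlead : 0 < ψ.leadingCoeff) {y b : ℕ} (hy : 1 ≤ y) (hb : b ≤ y)
    (hH : 2 ^ ψ.natDegree * lowerHeight ψ ≤ y) :
    (ψ.leadingCoeff : ℝ) * (y : ℝ) ^ ψ.natDegree / 2
      ≤ ((ψ.eval ((y : ℤ) + b) - ψ.eval (b : ℤ) : ℤ) : ℝ) := by
  set k := ψ.natDegree with hkdef
  have hlead' : (1 : ℝ) ≤ ψ.leadingCoeff := by exact_mod_cast hlead
  have hy' : (1 : ℝ) ≤ y := by exact_mod_cast hy
  have hb' : (b : ℝ) ≤ y := by exact_mod_cast hb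
  rw [eval_sub_eval_eq]
  push_cast
  have hlow : -(lowerHeight ψ * (2 * y : ℝ) ^ (k - 1))
      ≤ ∑ i ∈ Finset.range k, (ψ.coeff i : ℝ) * (((y : ℝ) + b) ^ i - (b : ℝ) ^ i) := by
    refine (neg_le_neg (sum_abs_coeff_mul_pow_le ψ hk (by linarith : (1 : ℝ) ≤ 2 * y))).trans ?_
    rw [← Finset.sum_neg_distrib]
    refine Finset.sum_le_sum fun i _ => ?_
    have h1 : 0 ≤ ((y : ℝ) + b) ^ i - (b : ℝ) ^ i :=
      sub_nonneg.2 (pow_le_pow_left₀ (Nat.cast_nonneg _) (by linarith) i)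
    have h2 : ((y : ℝ) + b) ^ i - (b : ℝ) ^ i ≤ (2 * y : ℝ) ^ i := by
      have h3 : ((y : ℝ) + b) ^ i ≤ (2 * y : ℝ) ^ i :=
        pow_le_pow_left₀ (by positivity) (by linarith) i
      have h4 : (0 : ℝ) ≤ (b : ℝ) ^ i := by positivity
      linarith
    refine neg_le_of_abs_le ?_
    rw [abs_mul, abs_of_nonneg h1]
    gcongr
  have hmain : (y : ℝ) ^ k ≤ ((y : ℝ) + b) ^ k - (b : ℝ) ^ k := by
    have := pow_add_pow_le (Nat.cast_nonneg (α := ℝ) y) (Nat.cast_nonneg b) (by omega : k ≠ 0)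
    linarith
  have hsmall : lowerHeight ψ * (2 * y : ℝ) ^ (k - 1) ≤ (y : ℝ) ^ k / 2 := by
    have h2k : (2 : ℝ) ^ k = 2 * 2 ^ (k - 1) := by rw [← pow_succ', Nat.sub_add_cancel hk]
    have hyk : (y : ℝ) ^ k = y * (y : ℝ) ^ (k - 1) := by rw [← pow_succ', Nat.sub_add_cancel hk]
    rw [mul_pow, hyk]
    have h5 : (2 : ℝ) ^ (k - 1) * lowerHeight ψ ≤ y / 2 := by
      rw [h2k] at hH
      linarith
    calc _ = ((2 : ℝ) ^ (k - 1) * lowerHeight ψ) * (y : ℝ) ^ (k - 1) := by ring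
      _ ≤ (y / 2) * (y : ℝ) ^ (k - 1) := by gcongr
      _ = _ := by ring
  have h6 : (ψ.leadingCoeff : ℝ) * (y : ℝ) ^ k
      ≤ ψ.leadingCoeff * (((y : ℝ) + b) ^ k - (b : ℝ) ^ k) := by gcongr
  have h7 : (y : ℝ) ^ k ≤ ψ.leadingCoeff * (y : ℝ) ^ k :=
    le_mul_of_one_le_left (by positivity) hlead'
  linarith

lemma eval_sub_eval_le (ψ : Polynomial ℤ) (hk : 1 ≤ ψ.natDegree)
    (hlead : 0 < ψ.leadingCoeff) {u v : ℤ} {X : ℝ} (hv : 0 ≤ v) (hvu : v ≤ u) (huX : (u : ℝ) ≤ X)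
    (hX : 1 ≤ X) :
    ((ψ.eval u - ψ.eval v : ℤ) : ℝ) ≤ (lowerHeight ψ + ψ.leadingCoeff) * X ^ ψ.natDegree := by
  have hlead' : (1 : ℝ) ≤ ψ.leadingCoeff := by exact_mod_cast hlead
  have hv' : (0 : ℝ) ≤ v := by exact_mod_cast hv
  have hvu' : (v : ℝ) ≤ u := by exact_mod_cast hvu
  have hpow : ∀ i : ℕ, |(u : ℝ) ^ i - (v : ℝ) ^ i| ≤ X ^ i := fun i => by
    have h1 : (v : ℝ) ^ i ≤ (u : ℝ) ^ i := pow_le_pow_left₀ hv' hvu' i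
    have h2 : (u : ℝ) ^ i ≤ X ^ i := pow_le_pow_left₀ (hv'.trans hvu') huX i
    have h3 : (0 : ℝ) ≤ (v : ℝ) ^ i := by positivity
    rw [abs_of_nonneg (by linarith)]
    linarith
  rw [eval_sub_eval_eq, add_mul]
  refine add_le_add ?_ (mul_le_mul_of_nonneg_left ((le_abs_self _).trans (hpow _)) (by linarith))
  calc _ ≤ ∑ i ∈ Finset.range ψ.natDegree, |(ψ.coeff i : ℝ)| * X ^ i := by
        refine Finset.sum_le_sum fun i _ => (le_abs_self _).trans ?_
        rw [abs_mul]
        exact mul_le_mul_of_nonneg_left (hpow i) (abs_nonneg _)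
    _ ≤ lowerHeight ψ * X ^ (ψ.natDegree - 1) := sum_abs_coeff_mul_pow_le ψ hk hX
    _ ≤ _ := mul_le_mul_of_nonneg_left (pow_le_pow_right₀ hX (Nat.sub_le _ _))
        (lowerHeight_nonneg ψ)

open Filter in
lemma eventually_log_pow_lt (B : ℝ) (j : ℕ) :
    ∀ᶠ n : ℕ in atTop, B * Real.log n ^ j < n := by
  have h := (Real.isLittleO_pow_log_id_atTop (n := j)).def (show (0 : ℝ) < 1 / (|B| + 1) by positivity)
  have h' := tendsto_natCast_atTop_atTop.eventually h
  filter_upwards [h', eventually_gt_atTop 1] with n hn hn1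
  have hn0 : (0 : ℝ) < n := Nat.cast_pos.2 (by omega)
  have hlog : 0 < Real.log n ^ j := pow_pos (Real.log_pos (by exact_mod_cast hn1)) j
  simp only [id, Real.norm_eq_abs, abs_of_pos hn0, abs_of_pos hlog] at hn
  rw [div_mul_eq_mul_div, one_mul, le_div_iff₀ (by positivity)] at hn
  have := le_abs_self B
  nlinarith

open Filter in
/-- If `n ≪ (W M) ^ k` with `W ≤ log n`, then `M` exceeds any fixed power of `log n`. -/
lemma eventually_log_pow_le_of_le_pow (B T : ℝ) (hB : 0 ≤ B) (k j : ℕ) :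
    ∀ᶠ n : ℕ in atTop, ∀ W M : ℕ, (W : ℝ) ≤ Real.log n →
      (n : ℝ) ≤ B * ((W : ℝ) * (M + 2)) ^ k → T * Real.log n ^ j ≤ M := by
  have hlog : ∀ᶠ n : ℕ in atTop, 1 ≤ Real.log n :=
    (Real.tendsto_log_atTop.comp tendsto_natCast_atTop_atTop).eventually_ge_atTop 1
  filter_upwards [eventually_log_pow_lt (B * (T + 2) ^ k) ((j + 1) * k), hlog] with n hn hl W M hW hM
  by_contra! hlt
  have h1 : (M : ℝ) + 2 ≤ (T + 2) * Real.log n ^ j := by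
    have : 1 ≤ Real.log n ^ j := one_le_pow₀ hl
    nlinarith
  have h2 : B * ((W : ℝ) * (M + 2)) ^ k ≤ B * (T + 2) ^ k * Real.log n ^ ((j + 1) * k) := by
    calc _ ≤ B * (Real.log n * ((T + 2) * Real.log n ^ j)) ^ k := by gcongr
      _ = _ := by
        rw [pow_mul, mul_assoc, ← mul_pow]
        congr 2
        ring
  linarith

open Filter in
lemma eventually_prod_primes_pow_le_log :
    ∀ᶠ n : ℕ in atTop, ∀ w : ℕ, w = ⌊Real.log (Real.log (Real.log (Real.log n)))⌋₊ →
      ((∏ p ∈ (Finset.range (w + 1)).filter Nat.Prime, p ^ w : ℕ) : ℝ) ≤ Real.log n := by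
  have hlog : Tendsto (fun n : ℕ => Real.log n) atTop atTop :=
    Real.tendsto_log_atTop.comp tendsto_natCast_atTop_atTop
  have h2 := Real.tendsto_log_atTop.comp hlog
  have h3 := Real.tendsto_log_atTop.comp h2
  have h4 := Real.tendsto_log_atTop.comp h3
  have hexp : ∀ᶠ L : ℝ in atTop, L * L * (L + 1) ≤ Real.exp (Real.exp L) := by
    have h := (Real.tendsto_pow_mul_exp_neg_atTop_nhds_zero 3).eventually_le_const
      (show (0 : ℝ) < 1 / 2 by norm_num)
    filter_upwards [h, eventually_ge_atTop 1] with L hL hL1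
    rw [Real.exp_neg, ← div_eq_mul_inv, div_le_iff₀ (Real.exp_pos L)] at hL
    have h1 := Real.add_one_le_exp (Real.exp L)
    nlinarith [sq_nonneg L]
  filter_upwards [h4.eventually hexp, h4.eventually_ge_atTop 0, h3.eventually_gt_atTop 0,
    h2.eventually_gt_atTop 0, hlog.eventually_gt_atTop 0] with n hn hL0 hlll hll hl w hw
  simp only [Function.comp_apply] at hn hL0 hlll hll
  set L := Real.log (Real.log (Real.log (Real.log n))) with hL
  have hwL : (w : ℝ) ≤ L := hw ▸ Nat.floor_le hL0
  have hprod : ∏ p ∈ (Finset.range (w + 1)).filter Nat.Prime, p ^ w ≤ (w ^ w) ^ (w + 1) := by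
    calc _ ≤ (w ^ w) ^ #((Finset.range (w + 1)).filter Nat.Prime) := by
          refine Finset.prod_le_pow_card _ _ _ fun p hp => ?_
          simp only [Finset.mem_filter, Finset.mem_range] at hp
          exact Nat.pow_le_pow_left (by omega) w
      _ ≤ (w ^ w) ^ (w + 1) := by
          refine Nat.pow_le_pow_right Nat.pow_self_pos ?_
          exact (Finset.card_filter_le _ _).trans (by simp)
  have hwexp : (w : ℝ) ≤ Real.exp w := by linarith [Real.add_one_le_exp (w : ℝ)]
  calc ((∏ p ∈ (Finset.range (w + 1)).filter Nat.Prime, p ^ w : ℕ) : ℝ)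
      ≤ (((w ^ w) ^ (w + 1) : ℕ) : ℝ) := Nat.cast_le.2 hprod
    _ = ((w : ℝ) ^ w) ^ (w + 1) := by push_cast; rfl
    _ ≤ (Real.exp w ^ w) ^ (w + 1) := by gcongr
    _ = Real.exp ((w : ℝ) * w * (w + 1)) := by
        rw [← Real.exp_nat_mul, ← Real.exp_nat_mul]
        congr 1
        push_cast
        ring
    _ ≤ Real.exp (L * L * (L + 1)) := by gcongr
    _ ≤ Real.exp (Real.exp (Real.exp L)) := Real.exp_le_exp.2 hn
    _ = Real.log n := by
        rw [hL, Real.exp_log hlll, Real.exp_log hll, Real.exp_log hl]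

end Growth

section Weights

lemma mul_ediv_eval_sub_eval (ψ : Polynomial ℤ) (W x b : ℤ) :
    W * ((ψ.eval (W * x + b) - ψ.eval b) / W) = ψ.eval (W * x + b) - ψ.eval b := by
  refine Int.mul_ediv_cancel' (dvd_trans ?_ (Polynomial.sub_dvd_eval_sub _ _ ψ))
  exact ⟨x, by ring⟩

lemma sum_abs_le_sum_abs_comp {ι α : Type*} [Fintype α] [DecidableEq α] {a : α → ℝ} {s : Finset ι}
    {φ : ι → α} (h : ∀ x, (¬ ∃ z ∈ s, x = φ z) → a x = 0) :
    ∑ x, |a x| ≤ ∑ z ∈ s, |a (φ z)| := by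
  calc ∑ x, |a x| = ∑ x ∈ s.image φ, |a x| := by
        refine (Finset.sum_subset (Finset.subset_univ _) fun x _ hx => ?_).symm
        rw [h x (fun ⟨z, hz, hxz⟩ => hx (Finset.mem_image.2 ⟨z, hz, hxz.symm⟩)), abs_zero]
    _ ≤ _ := Finset.sum_image_le_of_nonneg fun x _ => abs_nonneg (a x)

lemma abs_sub_div_le (ψ : Polynomial ℤ) (hk : 1 ≤ ψ.natDegree) (hlead : 0 < ψ.leadingCoeff)
    {W b M : ℕ} (hb : b < W) (hM : 1 ≤ M) (hH : 2 ^ ψ.natDegree * lowerHeight ψ ≤ M) {g : ℤ → ℤ}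
    (hg : ∀ x : ℤ, g x = (ψ.eval ((W : ℤ) * x + (b : ℤ)) - ψ.eval (b : ℤ)) / (W : ℤ))
    {z : ℕ} (hz : 1 ≤ z) (hzM : z ≤ M) :
    |((g z - g ((z : ℤ) - 1) : ℤ) : ℝ)| ≤ 4 * ψ.natDegree * 2 ^ ψ.natDegree / M * (g M : ℝ) := by
  have hW : 1 ≤ W := by omega
  have hW' : (1 : ℝ) ≤ W := by exact_mod_cast hW
  have hM' : (1 : ℝ) ≤ M := by exact_mod_cast hM
  have hMW : M ≤ W * M := Nat.le_mul_of_pos_left M hW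
  have hMW' : (M : ℝ) ≤ W * M := by exact_mod_cast hMW
  have hbW : b ≤ W * M := hb.le.trans (Nat.le_mul_of_pos_right W hM)
  have hbW' : (b : ℝ) ≤ W := by exact_mod_cast hb.le
  have hlow := lowerHeight_nonneg ψ
  have hlowM : lowerHeight ψ ≤ M := by
    have : (1 : ℝ) ≤ 2 ^ ψ.natDegree := one_le_pow₀ (by norm_num)
    nlinarith
  have hzM' : (z : ℝ) ≤ M := by exact_mod_cast hzM
  have hz' : (1 : ℤ) ≤ z := by exact_mod_cast hz
  have hWg : ∀ x : ℤ, (W : ℤ) * g x = ψ.eval ((W : ℤ) * x + b) - ψ.eval (b : ℤ) := fun x => by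
    rw [hg x, mul_ediv_eval_sub_eval]
  have hlower : (ψ.leadingCoeff : ℝ) * ((W : ℝ) * M) ^ ψ.natDegree / 2 ≤ W * g M := by
    have h := half_mul_pow_le_eval_sub_eval ψ hk hlead (hM.trans hMW) hbW
      (hH.trans (by exact_mod_cast hMW))
    have h2 := hWg M
    push_cast at h
    rw [← Int.cast_natCast W, ← Int.cast_mul, h2]
    push_cast
    exact h
  have hupper := mul_abs_eval_sub_eval_le ψ hk hlead (u := (W : ℤ) * z + b)
    (v := (W : ℤ) * ((z : ℤ) - 1) + b) (X := (W : ℝ) * (M + 1))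
    (add_nonneg (mul_nonneg (Int.natCast_nonneg _) (by omega)) (Int.natCast_nonneg _))
    (by nlinarith) (by push_cast; nlinarith) (by nlinarith) (by nlinarith)
  have hdiff : ψ.eval ((W : ℤ) * z + b) - ψ.eval ((W : ℤ) * ((z : ℤ) - 1) + b)
      = W * (g z - g ((z : ℤ) - 1)) := by
    rw [mul_sub (W : ℤ) (g z), hWg, hWg]
    ring
  rw [hdiff] at hupper
  push_cast at hupper ⊢
  rw [abs_mul, abs_of_nonneg (by linarith : (0 : ℝ) ≤ W)] at hupper
  have hlead' : (0 : ℝ) ≤ ψ.leadingCoeff := by exact_mod_cast hlead.le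
  have hXpow : ((W : ℝ) * (M + 1)) ^ ψ.natDegree ≤ 2 ^ ψ.natDegree * ((W : ℝ) * M) ^ ψ.natDegree := by
    rw [← mul_pow]
    exact pow_le_pow_left₀ (by positivity) (by nlinarith) _
  set D := |(g z : ℝ) - g ((z : ℤ) - 1)| with hD
  have hD0 : 0 ≤ D := abs_nonneg _
  rw [div_mul_eq_mul_div, le_div_iff₀ (by linarith)]
  refine le_of_mul_le_mul_left ?_ (mul_pos (by linarith : (0 : ℝ) < W) (by linarith : (0 : ℝ) < W))
  calc (W : ℝ) * W * (D * M) ≤ W * (M + 1) * (W * D) := by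
        have : 0 ≤ (W : ℝ) * W * D := by positivity
        nlinarith
    _ ≤ W * (2 * ψ.natDegree * ψ.leadingCoeff
          * (2 ^ ψ.natDegree * ((W : ℝ) * M) ^ ψ.natDegree)) := by
        refine hupper.trans ?_
        rw [show (W : ℝ) * z + b - (W * ((z : ℝ) - 1) + b) = W by ring]
        gcongr
    _ = W * (4 * ψ.natDegree * 2 ^ ψ.natDegree
          * (ψ.leadingCoeff * ((W : ℝ) * M) ^ ψ.natDegree / 2)) := by ring
    _ ≤ W * (4 * ψ.natDegree * 2 ^ ψ.natDegree * (W * g M)) := by gcongr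
    _ = _ := by ring

/-- The largest `M` with `g M < K N` satisfies `n ≪ (W M) ^ k`. -/
lemma le_mul_pow_of_maximal (ψ : Polynomial ℤ) (hk : 1 ≤ ψ.natDegree) (hlead : 0 < ψ.leadingCoeff)
    {W b M K N : ℕ} {t : ℝ} (hb : b < W) (hK : 0 < K) (ht : 0 ≤ t) (hN : 2 * t / W < N) {g : ℤ → ℤ}
    (hg : ∀ x : ℤ, g x = (ψ.eval ((W : ℤ) * x + (b : ℤ)) - ψ.eval (b : ℤ)) / (W : ℤ))
    (hM : ∀ x : ℕ, g (x : ℤ) < (K : ℤ) * N → x ≤ M) :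
    t ≤ (lowerHeight ψ + ψ.leadingCoeff) * ((W : ℝ) * (M + 2)) ^ ψ.natDegree := by
  have hW : (1 : ℝ) ≤ W := by exact_mod_cast (by omega : 1 ≤ W)
  have hbW : (b : ℝ) ≤ W := by exact_mod_cast hb.le
  have hge : (K : ℤ) * N ≤ g ((M + 1 : ℕ) : ℤ) := by
    by_contra! h
    have := hM _ h
    omega
  have hge' : (K : ℝ) * N ≤ (g ((M + 1 : ℕ) : ℤ) : ℝ) := by exact_mod_cast hge
  have hWg : (W : ℝ) * (g ((M + 1 : ℕ) : ℤ) : ℝ)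
      = ((ψ.eval ((W : ℤ) * ((M + 1 : ℕ) : ℤ) + b) - ψ.eval (b : ℤ) : ℤ) : ℝ) := by
    rw [← mul_ediv_eval_sub_eval, ← hg]
    push_cast
    rfl
  have hup := eval_sub_eval_le ψ hk hlead (u := (W : ℤ) * ((M + 1 : ℕ) : ℤ) + b) (v := (b : ℤ))
    (X := (W : ℝ) * (M + 2)) (Int.natCast_nonneg _) (by
      have : (0 : ℤ) ≤ (W : ℤ) * ((M + 1 : ℕ) : ℤ) := by positivity
      linarith) (by push_cast; nlinarith) (by nlinarith)
  rw [← hWg] at hup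
  rw [div_lt_iff₀ (by linarith)] at hN
  have hK' : (1 : ℝ) ≤ K := by exact_mod_cast hK
  have hN0 : (0 : ℝ) ≤ N := Nat.cast_nonneg _
  have h1 : (N : ℝ) ≤ g ((M + 1 : ℕ) : ℤ) := (le_mul_of_one_le_left hN0 hK').trans hge'
  nlinarith

lemma sum_abs_weight_le (ψ : Polynomial ℤ) (hk : 1 ≤ ψ.natDegree) (hlead : 0 < ψ.leadingCoeff)
    {W b W₀ b₀ M N : ℕ} [NeZero N] (hb : b < W) (hW₀ : 0 < W₀) (hb₀ : b₀ ≤ W₀)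
    (hM : 2 ^ 12 ≤ M) (hWM : (W * W₀) ^ 12 ≤ M) (hH : 2 ^ ψ.natDegree * lowerHeight ψ ≤ M)
    {g : ℤ → ℤ}
    (hg : ∀ x : ℤ, g x = (ψ.eval ((W : ℤ) * x + (b : ℤ)) - ψ.eval (b : ℤ)) / (W : ℤ))
    {a : ZMod N → ℝ}
    (ha : ∀ z : ℕ, 1 ≤ z → z ≤ M → a ((g (z : ℤ) : ℤ) : ZMod N) =
      ((g (z : ℤ) - g ((z : ℤ) - 1) : ℤ) : ℝ) * lam (W₀ * b + b₀) (W * W₀) z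
        / ((g (M : ℤ) : ℤ) : ℝ))
    (ha0 : ∀ x : ZMod N,
      (¬ ∃ z : ℕ, 1 ≤ z ∧ z ≤ M ∧ x = ((g (z : ℤ) : ℤ) : ZMod N)) → a x = 0) :
    ∑ x, |a x| ≤ 4 * ψ.natDegree * 2 ^ ψ.natDegree * 180 := by
  have hW : 0 < W := by omega
  have hM1 : 1 ≤ M := le_trans (by norm_num) hM
  have hM' : (0 : ℝ) < M := by exact_mod_cast hM1
  have hJM := Nat.pow_nthRoot_le (n := 12) (a := M) (Or.inl (by norm_num))
  have hMJ := Nat.lt_pow_nthRoot_add_one (n := 12) (by norm_num) M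
  have hle : ∀ t : ℕ, t ^ 12 ≤ M → t ≤ Nat.nthRoot 12 M := fun t ht =>
    Nat.lt_succ_iff.1 (lt_of_pow_lt_pow_left₀ 12 (Nat.zero_le _) (ht.trans_lt hMJ))
  have hc : W₀ * b + b₀ ≤ W * W₀ := by
    calc W₀ * b + b₀ ≤ W₀ * b + W₀ := by omega
      _ = (b + 1) * W₀ := by ring
      _ ≤ W * W₀ := Nat.mul_le_mul_right _ hb
  have hlam := sum_lam_le (Nat.mul_pos hW hW₀) hc (hle 2 hM) (hle _ hWM) hJM hMJ
  set c : ℝ := 4 * ψ.natDegree * 2 ^ ψ.natDegree / M with hcdef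
  calc ∑ x, |a x| ≤ ∑ z ∈ Finset.Icc 1 M, |a ((g (z : ℤ) : ℤ) : ZMod N)| := by
        refine sum_abs_le_sum_abs_comp fun x hx => ha0 x ?_
        rintro ⟨z, hz1, hzM, hxz⟩
        exact hx ⟨z, Finset.mem_Icc.2 ⟨hz1, hzM⟩, hxz⟩
    _ ≤ ∑ z ∈ Finset.Icc 1 M, c * lam (W₀ * b + b₀) (W * W₀) z := by
        refine Finset.sum_le_sum fun z hz => ?_
        obtain ⟨hz1, hzM⟩ := Finset.mem_Icc.1 hz
        rw [ha z hz1 hzM, mul_div_right_comm, abs_mul, abs_of_nonneg (lam_nonneg _ _ _), abs_div]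
        refine mul_le_mul_of_nonneg_right ?_ (lam_nonneg _ _ _)
        refine div_le_of_le_mul₀ (abs_nonneg _) (by positivity) ?_
        refine (abs_sub_div_le ψ hk hlead hb hM1 hH hg hz1 hzM).trans ?_
        exact mul_le_mul_of_nonneg_left (le_abs_self _) (by positivity)
    _ ≤ c * (180 * M) := by
        rw [← Finset.mul_sum]
        exact mul_le_mul_of_nonneg_left hlam (by positivity)
    _ = _ := by
        rw [hcdef]
        field_simp

end Weights

/-- Lemma 2.7 of the paper: there is a constant `C₂` depending only on `k` such
that, in the setup of the paper (with `ℛ = {r : |𝔞̃(r)| ≥ η}`,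
`ℬ = {x : ‖xr/N‖ ≤ ε for all r ∈ ℛ}`, `𝔟 = 1_ℬ/|ℬ|`, `𝔞' = 𝔞 * 𝔟 * 𝔟`), for all
sufficiently large `n`, all `η, ε ∈ (0,1)` and every `A ⊆ ℤ_N`:
`|Σ_{x+y=z} 1_A(x)1_A(y)𝔞(z) − Σ_{x+y=z} 1_A(x)1_A(y)𝔞'(z)|
  ≤ C₂ K (ε² η^{−k·2^{k+3}} + η^{1/(k·2^{k+3}+1)}) N`. -/
theorem transfer_error_bound (k : ℕ) (hk : 1 ≤ k) :
    ∃ C₂ : ℝ, 0 < C₂ ∧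
    ∀ ψ : Polynomial ℤ, ψ.natDegree = k → 0 < ψ.leadingCoeff →
    ∀ m b₀ W₀ K : ℕ, 0 < m → 0 < b₀ → b₀ ≤ W₀ → Nat.gcd b₀ W₀ = 1 → 0 < K →
    ∃ n₀ : ℕ, ∀ n : ℕ, n₀ ≤ n →
    ∀ (w W : ℕ),
      w = ⌊Real.log (Real.log (Real.log (Real.log n)))⌋₊ →
      W = ∏ p ∈ (Finset.range (w + 1)).filter Nat.Prime, p ^ w →
    ∀ (N : ℕ) [NeZero N], N.Prime →
      (2 * (n : ℝ)) / W < N → (N : ℝ) ≤ (2 + (1 / 10000 : ℝ) / ((K : ℝ) * m)) * n / W →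
    ∀ b : ℕ, b < W →
      Nat.gcd (W₀ * b + b₀) (W * W₀) = 1 →
      Int.gcd (ψ.derivative.eval (b : ℤ)) (ψ.leadingCoeff * (W : ℤ) ^ (k - 1)) = K →
      Int.gcd (ψ.derivative.eval (b : ℤ)) (W : ℤ) = K →
    ∀ ψbW : ℤ → ℤ,
      (∀ x : ℤ, ψbW x = (ψ.eval ((W : ℤ) * x + (b : ℤ)) - ψ.eval (b : ℤ)) / (W : ℤ)) →
    ∀ M : ℕ, ψbW (M : ℤ) < (K : ℤ) * N → (∀ x : ℕ, ψbW (x : ℤ) < (K : ℤ) * N → x ≤ M) →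
    ∀ 𝔞 : ZMod N → ℝ,
      (∀ z : ℕ, 1 ≤ z → z ≤ M →
        𝔞 ((ψbW (z : ℤ) : ℤ) : ZMod N) =
          ((ψbW (z : ℤ) - ψbW ((z : ℤ) - 1) : ℤ) : ℝ) * lam (W₀ * b + b₀) (W * W₀) z /
            ((ψbW (M : ℤ) : ℤ) : ℝ)) →
      (∀ x : ZMod N, (¬ ∃ z : ℕ, 1 ≤ z ∧ z ≤ M ∧ x = ((ψbW (z : ℤ) : ℤ) : ZMod N)) →
        𝔞 x = 0) →
    ∀ η ε : ℝ, 0 < η → η < 1 → 0 < ε → ε < 1 →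
    ∀ ℛ : Finset (ZMod N), (∀ r : ZMod N, r ∈ ℛ ↔ η ≤ ‖dft N 𝔞 r‖) →
    ∀ ℬ : Finset (ZMod N),
      (∀ x : ZMod N, x ∈ ℬ ↔
        ∀ r ∈ ℛ, nint (((x.val : ℕ) : ℝ) * ((r.val : ℕ) : ℝ) / N) ≤ ε) →
    ∀ 𝔟 : ZMod N → ℝ, (∀ x, 𝔟 x = (if x ∈ ℬ then (1 : ℝ) else 0) / (ℬ.card : ℝ)) →
    ∀ 𝔞' : ZMod N → ℝ,
      (∀ x, 𝔞' x = ∑ y : ZMod N, (∑ u : ZMod N, 𝔞 u * 𝔟 (y - u)) * 𝔟 (x - y)) →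
    ∀ A : Finset (ZMod N),
      |(∑ x : ZMod N, ∑ y : ZMod N,
          (if x ∈ A then (1 : ℝ) else 0) * (if y ∈ A then (1 : ℝ) else 0) * 𝔞 (x + y))
        - (∑ x : ZMod N, ∑ y : ZMod N,
          (if x ∈ A then (1 : ℝ) else 0) * (if y ∈ A then (1 : ℝ) else 0) * 𝔞' (x + y))|
        ≤ C₂ * K * (ε ^ 2 * η ^ (-((k : ℝ) * 2 ^ (k + 3)))
            + η ^ ((1 : ℝ) / ((k : ℝ) * 2 ^ (k + 3) + 1))) * N := by
  set C : ℝ := 4 * k * 2 ^ k * 180 with hC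
  have hC0 : 0 ≤ C := by positivity
  refine ⟨4 * Real.pi ^ 2 * C + 4, by positivity, ?_⟩
  intro ψ hdeg hlead m b₀ W₀ K _ hb₀ hbW₀ _ hK
  have hkψ : 1 ≤ ψ.natDegree := hdeg ▸ hk
  set H := lowerHeight ψ with hH
  have hH0 : 0 ≤ H := lowerHeight_nonneg ψ
  have hlead' : (0 : ℝ) < ψ.leadingCoeff := by exact_mod_cast hlead
  set T : ℝ := 2 ^ 12 + (W₀ : ℝ) ^ 12 + 2 ^ k * H with hT
  have hlog : ∀ᶠ n : ℕ in Filter.atTop, 1 ≤ Real.log n :=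
    (Real.tendsto_log_atTop.comp tendsto_natCast_atTop_atTop).eventually_ge_atTop 1
  obtain ⟨n₀, hn₀⟩ := Filter.eventually_atTop.1 (hlog.and (eventually_prod_primes_pow_le_log.and
    (eventually_log_pow_le_of_le_pow (H + ψ.leadingCoeff) T (by positivity) k 12)))
  refine ⟨n₀, ?_⟩
  intro n hn w W hw hWdef N _ _ hNlow _ b hb _ _ _ g hg M _ hM 𝔞 h𝔞 h𝔞0 η ε hη hη1 hε _ ℛ hℛ ℬ hℬ
    𝔟 h𝔟 𝔞' h𝔞' A
  obtain ⟨hlogn, hprod, hsize⟩ := hn₀ n hn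
  have hWlog : (W : ℝ) ≤ Real.log n := by
    rw [hWdef]
    exact hprod w hw
  have hgrow := hsize W M hWlog (hdeg ▸ le_mul_pow_of_maximal ψ hkψ hlead hb hK
    (Nat.cast_nonneg n) hNlow hg hM)
  have hlogpow : 1 ≤ Real.log n ^ 12 := one_le_pow₀ hlogn
  have hle : ∀ t : ℝ, 0 ≤ t → t ≤ T → t * Real.log n ^ 12 ≤ M := fun t _ ht =>
    (mul_le_mul_of_nonneg_right ht (by positivity)).trans hgrow
  have hle' : ∀ t : ℝ, 0 ≤ t → t ≤ T → t ≤ M := fun t h0 ht =>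
    (le_mul_of_one_le_right h0 hlogpow).trans (hle t h0 ht)
  have hHT : 0 ≤ 2 ^ k * H := by positivity
  have hWT : (0 : ℝ) ≤ (W₀ : ℝ) ^ 12 := by positivity
  have hM12 : 2 ^ 12 ≤ M := by
    have := hle' (2 ^ 12) (by norm_num) (by linarith)
    exact_mod_cast this
  have hMW : (W * W₀) ^ 12 ≤ M := by
    have h1 : (W : ℝ) ^ 12 ≤ Real.log n ^ 12 := pow_le_pow_left₀ (Nat.cast_nonneg _) hWlog 12
    have h2 : ((W : ℝ) * W₀) ^ 12 ≤ M := by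
      refine le_trans ?_ (hle ((W₀ : ℝ) ^ 12) hWT (by linarith))
      rw [mul_pow, mul_comm]
      exact mul_le_mul_of_nonneg_left h1 hWT
    exact_mod_cast h2
  have hsum : ∑ x, |𝔞 x| ≤ C := by
    have h := sum_abs_weight_le ψ hkψ hlead hb (hb₀.trans_le hbW₀) hbW₀ hM12 hMW
      (hdeg ▸ hle' _ hHT (by linarith [show (0 : ℝ) < 2 ^ 12 by norm_num])) hg h𝔞 h𝔞0
    rwa [hdeg] at h
  refine (abs_sum_sub_sum_bohr_conv_le hsum hη hε hℛ hℬ h𝔟 h𝔞' A).trans ?_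
  refine mul_le_mul_of_nonneg_right ?_ (Nat.cast_nonneg N)
  set P := η ^ (-((k : ℝ) * 2 ^ (k + 3))) with hP
  set Q := η ^ ((1 : ℝ) / ((k : ℝ) * 2 ^ (k + 3) + 1)) with hQ
  have hP1 : 1 ≤ P :=
    Real.one_le_rpow_of_pos_of_le_one_of_nonpos hη hη1.le (neg_nonpos.2 (by positivity))
  have hQη : η ≤ Q := by
    have h := Real.rpow_le_rpow_of_exponent_ge hη hη1.le
      (show (1 : ℝ) / ((k : ℝ) * 2 ^ (k + 3) + 1) ≤ 1 from
        div_le_one_of_le₀ (le_add_of_nonneg_left (by positivity)) (by positivity))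
    rwa [Real.rpow_one] at h
  have hK1 : (1 : ℝ) ≤ K := by exact_mod_cast hK
  have hQ0 : 0 ≤ Q := hη.le.trans hQη
  have hπ : 0 ≤ 4 * Real.pi ^ 2 * C := by positivity
  calc 4 * Real.pi ^ 2 * C * ε ^ 2 + 4 * η
      ≤ 4 * Real.pi ^ 2 * C * (ε ^ 2 * P) + 4 * Q := by
        gcongr
        exact le_mul_of_one_le_right (by positivity) hP1
    _ ≤ (4 * Real.pi ^ 2 * C + 4) * (ε ^ 2 * P + Q) := by
        have h1 : 0 ≤ ε ^ 2 * P := by positivity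
        nlinarith
    _ ≤ (4 * Real.pi ^ 2 * C + 4) * K * (ε ^ 2 * P + Q) := by
        refine mul_le_mul_of_nonneg_right (le_mul_of_one_le_right (by positivity) hK1) ?_
        positivity
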